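/- Let q ≥ 4 be a prime power and H = PSL₂(F_q). Then for every integer k with 2 ≤ k and k·|Aut H| ≤ φ₂(H), the direct power Hᵏ admits an unmixed Beauville structure. -/

import Mathlib

open scoped MatrixGroups

/-- `Σ(T)`: the union of all conjugates of the cyclic subgroups generated by the
three entries of the triple `T = (a, b, c)`. -/
def SigmaSet {G : Type*} [Group G] (T : G × G × G) : Set G :=
  {x | ∃ g : G, g * x * g⁻¹ ∈
    (Subgroup.zpowers T.1 : Set G) ∪ (Subgroup.zpowers T.2.1 : Set G) ∪
      (Subgroup.zpowers T.2.2 : Set G)}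

/-- `T = (a,b,c)` is a generating triple: `a*b*c = 1` and `{a,b,c}` generates. -/
def IsGenTriple {G : Type*} [Group G] (T : G × G × G) : Prop :=
  T.1 * T.2.1 * T.2.2 = 1 ∧ Subgroup.closure {T.1, T.2.1, T.2.2} = ⊤

/-- `T` is hyperbolic: the reciprocals of the orders of its entries sum to less than 1. -/
def IsHyperbolic {G : Type*} [Group G] (T : G × G × G) : Prop :=
  (orderOf T.1 : ℚ)⁻¹ + (orderOf T.2.1 : ℚ)⁻¹ + (orderOf T.2.2 : ℚ)⁻¹ < 1

/-- An unmixed Beauville structure on `G`: a pair of hyperbolic generating triples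
`T₁, T₂` with `Σ(T₁) ∩ Σ(T₂) = {1}`. -/
def HasBeauvilleStructure (G : Type*) [Group G] : Prop :=
  ∃ T₁ T₂ : G × G × G, IsGenTriple T₁ ∧ IsHyperbolic T₁ ∧ IsGenTriple T₂ ∧ IsHyperbolic T₂ ∧
    SigmaSet T₁ ∩ SigmaSet T₂ = {1}

/-- `φ₂(H)`: the number of ordered generating pairs of `H`. -/
noncomputable def phi2 (H : Type*) [Group H] : ℕ :=
  Nat.card {p : H × H // Subgroup.closure {p.1, p.2} = ⊤}

/-- Two triples are equivalent if some automorphism carries one to the other entrywise. -/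
def TripleEquiv {H : Type*} [Group H] (T T' : H × H × H) : Prop :=
  ∃ α : MulAut H, α T.1 = T'.1 ∧ α T.2.1 = T'.2.1 ∧ α T.2.2 = T'.2.2

section DirectPowers

variable {H : Type*} [Group H]

theorem exists_mem_closure_apply_eq {ι : Type*} (a b : ι → H) (j : ι)
    (hgen : Subgroup.closure {a j, b j} = ⊤) (h : H) :
    ∃ x ∈ Subgroup.closure {a, b}, x j = h := by
  have : (Subgroup.closure {a, b}).map (Pi.evalMonoidHom (fun _ : ι => H) j) = ⊤ := by
    rw [MonoidHom.map_closure, Set.image_pair]; exact hgen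
  have hh : h ∈ (Subgroup.closure {a, b}).map (Pi.evalMonoidHom (fun _ : ι => H) j) := by
    rw [this]; trivial
  obtain ⟨x, hx, rfl⟩ := hh
  exact ⟨x, hx, rfl⟩

/-- Values at `j` of the elements of `K` that are trivial on `s`. -/
def sliceSubgroup {ι : Type*} (K : Subgroup (ι → H)) (s : Set ι) (j : ι) : Subgroup H :=
  (K ⊓ ⨅ i ∈ s, (Pi.evalMonoidHom (fun _ : ι => H) i).ker).map (Pi.evalMonoidHom (fun _ : ι => H) j)

theorem mem_sliceSubgroup {ι : Type*} {K : Subgroup (ι → H)} {s : Set ι} {j : ι} {h : H} :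
    h ∈ sliceSubgroup K s j ↔ ∃ x ∈ K, (∀ i ∈ s, x i = 1) ∧ x j = h := by
  simp [sliceSubgroup, Subgroup.mem_iInf, MonoidHom.mem_ker, and_assoc]

theorem sliceSubgroup_normal {ι : Type*} {K : Subgroup (ι → H)} {s : Set ι} {j : ι}
    (hK : ∀ h, ∃ x ∈ K, x j = h) : (sliceSubgroup K s j).Normal := by
  refine ⟨fun n hn g => ?_⟩
  rw [mem_sliceSubgroup] at hn ⊢
  obtain ⟨x, hx, hs, rfl⟩ := hn
  obtain ⟨y, hy, rfl⟩ := hK g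
  exact ⟨y * x * y⁻¹, K.mul_mem (K.mul_mem hy hx) (K.inv_mem hy),
    fun i hi => by simp [hs i hi], by simp⟩

theorem slice_trivial_or_full [IsSimpleGroup H] {ι : Type*} {K : Subgroup (ι → H)} (s : Set ι)
    {j : ι} (hK : ∀ h, ∃ x ∈ K, x j = h) :
    (∀ x ∈ K, (∀ i ∈ s, x i = 1) → x j = 1) ∨
      ∀ h, ∃ x ∈ K, (∀ i ∈ s, x i = 1) ∧ x j = h := by
  have hN : (sliceSubgroup K s j).Normal := sliceSubgroup_normal hK
  rcases hN.eq_bot_or_eq_top with h | h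
  · left
    intro x hx hs
    have : x j ∈ sliceSubgroup K s j := mem_sliceSubgroup.2 ⟨x, hx, hs, rfl⟩
    rwa [h, Subgroup.mem_bot] at this
  · right
    intro g
    exact mem_sliceSubgroup.1 (h ▸ Subgroup.mem_top g)

theorem exists_mulAut_of_ker_le [IsSimpleGroup H] {ι : Type*} {K : Subgroup (ι → H)} {i j : ι}
    (hi : ∀ h, ∃ x ∈ K, x i = h) (hj : ∀ h, ∃ x ∈ K, x j = h)
    (hker : ∀ x ∈ K, x i = 1 → x j = 1) :
    ∃ φ : MulAut H, ∀ x ∈ K, φ (x i) = x j := by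
  let f : K →* H := (Pi.evalMonoidHom (fun _ : ι => H) i).comp K.subtype
  let g : K →* H := (Pi.evalMonoidHom (fun _ : ι => H) j).comp K.subtype
  have hf : Function.Surjective f := fun h => by
    obtain ⟨x, hx, e⟩ := hi h
    exact ⟨⟨x, hx⟩, e⟩
  have hg : Function.Surjective g := fun h => by
    obtain ⟨x, hx, e⟩ := hj h
    exact ⟨⟨x, hx⟩, e⟩
  have hfg : f.ker ≤ g.ker := fun x hx => hker x.1 x.2 hx
  let φ : H →* H := f.liftOfSurjective hf ⟨g, hfg⟩
  have hφ : ∀ x, φ (f x) = g x := fun x =>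
    DFunLike.congr_fun (f.liftOfRightInverse_comp _ (Function.rightInverse_surjInv hf) ⟨g, hfg⟩) x
  have hs : Function.Surjective φ := fun h => by
    obtain ⟨x, rfl⟩ := hg h
    exact ⟨f x, hφ x⟩
  have hinj : Function.Injective φ := by
    rw [← MonoidHom.ker_eq_bot_iff]
    rcases (inferInstance : φ.ker.Normal).eq_bot_or_eq_top with h | h
    · exact h
    · exfalso
      obtain ⟨u, hu⟩ := exists_ne (1 : H)
      obtain ⟨v, rfl⟩ := hs u
      exact hu (MonoidHom.mem_ker.1 (h ▸ Subgroup.mem_top v))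
  exact ⟨MulEquiv.ofBijective φ ⟨hinj, hs⟩, fun x hx => hφ ⟨x, hx⟩⟩

/-- Goursat–Ribet: pairwise inequivalent generating pairs of a nonabelian simple group generate
the full direct power. -/
theorem closure_pair_pi_eq_top [IsSimpleGroup H] (hcomm : ∃ x y : H, x * y ≠ y * x)
    {ι : Type*} [Finite ι] (a b : ι → H)
    (hgen : ∀ i, Subgroup.closure {a i, b i} = ⊤)
    (hne : ∀ i j, i ≠ j → ¬ ∃ φ : MulAut H, φ (a i) = a j ∧ φ (b i) = b j) :
    Subgroup.closure {a, b} = ⊤ := by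
  classical
  have := Fintype.ofFinite ι
  set K := Subgroup.closure {a, b} with hKdef
  have hK : ∀ j h, ∃ x ∈ K, x j = h := fun j h => exists_mem_closure_apply_eq a b j (hgen j) h
  have hcenter : ∀ x : H, (∀ y, x * y = y * x) → x = 1 := by
    intro x hx
    rcases (inferInstance : (Subgroup.center H).Normal).eq_bot_or_eq_top with h | h
    · have : x ∈ Subgroup.center H := Subgroup.mem_center_iff.2 fun g => (hx g).symm
      rwa [h, Subgroup.mem_bot] at this
    · exfalso
      obtain ⟨u, v, huv⟩ := hcomm
      have : u ∈ Subgroup.center H := h ▸ Subgroup.mem_top u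
      exact huv (Subgroup.mem_center_iff.1 this v).symm
  have key : ∀ s : Finset ι, ∀ f : ι → H, ∃ x ∈ K, ∀ i ∈ s, x i = f i := by
    intro s
    induction s using Finset.induction_on with
    | empty => exact fun f => ⟨1, K.one_mem, by simp⟩
    | insert j s hj ih =>
      rcases slice_trivial_or_full (s : Set ι) (hK j) with h0 | hfull
      · exfalso
        by_cases hM : ∀ i ∈ s, ∀ x ∈ K, (∀ l ∈ (s : Set ι) \ {i}, x l = 1) → x j = 1
        · have claim : ∀ t : Finset ι, t ⊆ s → ∀ x ∈ K, (∀ i ∈ s, i ∉ t → x i = 1) → x j = 1 := by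
            intro t
            induction t using Finset.induction_on with
            | empty => exact fun _ x hx h => h0 x hx fun i hi => h i hi (by simp)
            | insert i t hit iht =>
              intro hts x hx h
              obtain ⟨y, hy, hyx⟩ := ih (Pi.mulSingle i (x i))
              have his : i ∈ s := hts (Finset.mem_insert_self i t)
              have hyj : y j = 1 := hM i his y hy fun l hl => by
                rw [hyx l hl.1, Pi.mulSingle_eq_of_ne hl.2]
              have := iht (fun l hl => hts (Finset.mem_insert_of_mem hl)) (x * y⁻¹)
                (K.mul_mem hx (K.inv_mem hy)) fun l hl hlt => by
                  by_cases hli : l = i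
                  · subst hli; simp [hyx l hl]
                  · simp [hyx l hl, Pi.mulSingle_eq_of_ne hli, h l hl (by simp [hli, hlt])]
              simpa [hyj] using this
          obtain ⟨u, hu⟩ := exists_ne (1 : H)
          obtain ⟨x, hx, rfl⟩ := hK j u
          exact hu (claim s subset_rfl x hx fun i hi hi' => absurd hi hi')
        · push Not at hM
          obtain ⟨i, his, x₀, hx₀, hx₀s, hx₀j⟩ := hM
          have hij : i ≠ j := fun h => hj (h ▸ his)
          have hfull : ∀ h, ∃ x ∈ K, (∀ l ∈ (s : Set ι) \ {i}, x l = 1) ∧ x j = h := by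
            rcases slice_trivial_or_full ((s : Set ι) \ {i}) (hK j) with h | h
            · exact absurd (h x₀ hx₀ hx₀s) hx₀j
            · exact h
          have hker : ∀ x ∈ K, x i = 1 → x j = 1 := by
            intro x hx hxi
            refine hcenter _ fun h => ?_
            obtain ⟨y, hy, hys, rfl⟩ := hfull h
            have := h0 (x * y * x⁻¹ * y⁻¹) (K.mul_mem (K.mul_mem (K.mul_mem hx hy) (K.inv_mem hx))
              (K.inv_mem hy)) fun l hl => by
                by_cases hli : l = i
                · subst hli; simp [hxi]
                · simp [hys l ⟨hl, hli⟩]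
            simp only [Pi.mul_apply, Pi.inv_apply] at this
            rwa [mul_inv_eq_one, mul_inv_eq_iff_eq_mul] at this
          obtain ⟨φ, hφ⟩ := exists_mulAut_of_ker_le (hK i) (hK j) hker
          exact hne i j hij ⟨φ, hφ a (Subgroup.subset_closure (by simp)),
            hφ b (Subgroup.subset_closure (by simp))⟩
      · intro f
        obtain ⟨x, hx, hxf⟩ := ih f
        obtain ⟨y, hy, hys, hyj⟩ := hfull ((x j)⁻¹ * f j)
        refine ⟨x * y, K.mul_mem hx hy, fun i hi => ?_⟩
        rcases Finset.mem_insert.1 hi with rfl | hi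
        · simp [hyj]
        · simp [hxf i hi, hys i hi]
  rw [eq_top_iff]
  intro f _
  obtain ⟨x, hx, hxf⟩ := key Finset.univ f
  have : x = f := funext fun i => hxf i (Finset.mem_univ i)
  exact this ▸ hx

/-- A pairwise inequivalent family of generating pairs extends to one of size `k` as soon as
`k * |Aut H|` does not exceed the number of generating pairs. -/
theorem exists_extension_inequivalent [Finite H] (phi : ℕ)
    (hphi : phi = Nat.card {p : H × H // Subgroup.closure {p.1, p.2} = ⊤}) {m : ℕ}
    (v : Fin m → H × H) (hgen : ∀ i, Subgroup.closure {(v i).1, (v i).2} = ⊤)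
    (hne : ∀ i j, i ≠ j → ¬ ∃ φ : MulAut H, φ (v i).1 = (v j).1 ∧ φ (v i).2 = (v j).2)
    {k : ℕ} (hmk : m ≤ k) (hk : k * Nat.card (MulAut H) ≤ phi) :
    ∃ w : Fin k → H × H, (∀ i, Subgroup.closure {(w i).1, (w i).2} = ⊤) ∧
      (∀ i j, i ≠ j → ¬ ∃ φ : MulAut H, φ (w i).1 = (w j).1 ∧ φ (w i).2 = (w j).2) ∧
      ∀ i : Fin m, w (i.castLE hmk) = v i := by
  classical
  induction k, hmk using Nat.le_induction with
  | base => exact ⟨v, hgen, hne, fun i => rfl⟩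
  | succ k hmk ih =>
    have hA : 0 < Nat.card (MulAut H) := Nat.card_pos
    obtain ⟨w, hw, hwne, hwv⟩ := ih (by nlinarith)
    have hex : ∃ p : H × H, Subgroup.closure {p.1, p.2} = ⊤ ∧
        ∀ i (φ : MulAut H), (φ (w i).1, φ (w i).2) ≠ p := by
      by_contra! hcon
      have hsurj : Function.Surjective
          (fun x : {x : Fin k × MulAut H // Subgroup.closure {x.2 (w x.1).1, x.2 (w x.1).2} = ⊤} =>
            (⟨(x.1.2 (w x.1.1).1, x.1.2 (w x.1.1).2), x.2⟩ :
              {p : H × H // Subgroup.closure {p.1, p.2} = ⊤})) := by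
        rintro ⟨p, hp⟩
        obtain ⟨i, φ, h⟩ := hcon p hp
        subst h
        exact ⟨⟨(i, φ), hp⟩, rfl⟩
      have h1 := Nat.card_le_card_of_surjective _ hsurj
      have h2 := Nat.card_le_card_of_injective (Subtype.val : {x : Fin k × MulAut H //
        Subgroup.closure {x.2 (w x.1).1, x.2 (w x.1).2} = ⊤} → _) Subtype.val_injective
      rw [Nat.card_prod, Nat.card_fin] at h2
      rw [← hphi] at h1
      nlinarith
    obtain ⟨p, hp, hpne⟩ := hex
    refine ⟨Fin.snoc w p, fun i => ?_, fun i j hij => ?_, fun i => ?_⟩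
    · induction i using Fin.lastCases with
      | last => simpa using hp
      | cast i => simpa using hw i
    · rintro ⟨φ, h1, h2⟩
      induction i using Fin.lastCases with
      | last =>
        induction j using Fin.lastCases with
        | last => exact hij rfl
        | cast j =>
          simp only [Fin.snoc_last, Fin.snoc_castSucc] at h1 h2
          exact hpne j φ⁻¹ (Prod.ext (by simp [← h1]) (by simp [← h2]))
      | cast i =>
        induction j using Fin.lastCases with
        | last =>
          simp only [Fin.snoc_last, Fin.snoc_castSucc] at h1 h2
          exact hpne i φ (Prod.ext h1 h2)
        | cast j =>
          simp only [Fin.snoc_castSucc] at h1 h2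
          exact hwne i j (fun h => hij (by rw [h])) ⟨φ, h1, h2⟩
    · have : (i.castLE (hmk.trans k.le_succ)) = (i.castLE hmk).castSucc := rfl
      rw [this, Fin.snoc_castSucc, hwv]

end DirectPowers

section Codes

variable {H : Type*} [Group H]

/-- Codes `0`, `1`, `2` prescribe the order `N 0`, `N 1`, `N 2`; code `3` only asks for an order
coprime to `N 2`. -/
def HasCode (N : Fin 3 → ℕ) (e : Fin 4) (h : H) : Prop :=
  if he : (e : ℕ) < 3 then orderOf h = N ⟨e, he⟩ else (orderOf h).Coprime (N 2)

/-- The code `e` forces an order coprime to `N τ`. -/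
def CodeOff (e : Fin 4) (τ : Fin 3) : Prop :=
  ((e : ℕ) < 3 ∧ (e : ℕ) ≠ τ) ∨ ((e : ℕ) = 3 ∧ τ = 2)

instance (e : Fin 4) (τ : Fin 3) : Decidable (CodeOff e τ) := by
  unfold CodeOff; infer_instance

/-- The codes `e` and `e'` cannot be satisfied by elements of equal order. -/
def CodeClash (e e' : Fin 4) : Prop :=
  ((e : ℕ) < 3 ∧ (e' : ℕ) < 3 ∧ e ≠ e') ∨ (e = 3 ∧ e' = 2) ∨ (e = 2 ∧ e' = 3)

instance (e e' : Fin 4) : Decidable (CodeClash e e') := by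
  unfold CodeClash; infer_instance

theorem hasCode_iff_orderOf {N : Fin 3 → ℕ} {e : Fin 4} {h : H} (he : (e : ℕ) < 3) :
    HasCode N e h ↔ orderOf h = N ⟨e, he⟩ := by
  simp [HasCode, he]

/-- A generating triple with product one whose entries have prescribed codes. -/
def HasColumn (H : Type*) [Group H] (N : Fin 3 → ℕ) (t : Fin 3 → Fin 4) : Prop :=
  ∃ a b c : H, a * b * c = 1 ∧ Subgroup.closure {a, b} = ⊤ ∧
    HasCode N (t 0) a ∧ HasCode N (t 1) b ∧ HasCode N (t 2) c

/-- Pairwise coprime nontrivial numbers such that every element of `H` is killed by one. -/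
structure OrderSystem (H : Type*) [Group H] (N : Fin 3 → ℕ) : Prop where
  two_le : ∀ τ, 2 ≤ N τ
  coprime : ∀ σ τ, σ ≠ τ → (N σ).Coprime (N τ)
  exists_pow_eq_one : ∀ h : H, ∃ τ, h ^ N τ = 1

variable {N : Fin 3 → ℕ}

theorem coprime_of_codeOff (hN : OrderSystem H N) {e : Fin 4} {τ : Fin 3} {h : H}
    (he : HasCode N e h) (ho : CodeOff e τ) : (orderOf h).Coprime (N τ) := by
  rcases ho with ⟨h3, hne⟩ | ⟨h3, rfl⟩
  · rw [(hasCode_iff_orderOf h3).1 he]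
    exact hN.coprime _ _ fun h => hne (by rw [← h])
  · simpa [HasCode, h3] using he

theorem not_coprime_self (hN : OrderSystem H N) (τ : Fin 3) : ¬ (N τ).Coprime (N τ) := by
  rw [Nat.coprime_self]
  have := hN.two_le τ
  omega

theorem orderOf_ne_of_codeClash (hN : OrderSystem H N) {e e' : Fin 4} {h h' : H}
    (he : HasCode N e h) (he' : HasCode N e' h') (hc : CodeClash e e') :
    orderOf h ≠ orderOf h' := by
  intro hh
  rcases hc with ⟨h3, h3', hne⟩ | ⟨rfl, rfl⟩ | ⟨rfl, rfl⟩
  · rw [hasCode_iff_orderOf h3] at he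
    rw [hasCode_iff_orderOf h3'] at he'
    rw [he, he'] at hh
    have := hN.coprime ⟨e, h3⟩ ⟨e', h3'⟩ (fun h => hne (Fin.ext (by simpa using h)))
    rw [hh] at this
    exact not_coprime_self hN _ this
  · have h1 : (orderOf h).Coprime (N 2) := he
    have h2 : orderOf h' = N 2 := he'
    rw [hh, h2] at h1
    exact not_coprime_self hN _ h1
  · have h1 : (orderOf h').Coprime (N 2) := he'
    have h2 : orderOf h = N 2 := he
    rw [← hh, h2] at h1
    exact not_coprime_self hN _ h1

/-- Product of the orders other than `N τ`. -/
def coOrder (N : Fin 3 → ℕ) (τ : Fin 3) : ℕ := N (τ + 1) * N (τ + 2)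

theorem dvd_coOrder (N : Fin 3 → ℕ) {σ τ : Fin 3} (h : σ ≠ τ) : N σ ∣ coOrder N τ := by
  have : σ = τ + 1 ∨ σ = τ + 2 := by revert σ τ; decide
  rcases this with rfl | rfl
  · exact Dvd.intro _ rfl
  · exact Dvd.intro_left _ rfl

theorem pow_coOrder_eq_one (hN : OrderSystem H N) {τ : Fin 3} {h : H}
    (hc : (orderOf h).Coprime (N τ)) : h ^ coOrder N τ = 1 := by
  obtain ⟨σ, hσ⟩ := hN.exists_pow_eq_one h
  by_cases hst : σ = τ
  · subst hst
    have : orderOf h = 1 := Nat.Coprime.eq_one_of_dvd hc (orderOf_dvd_of_pow_eq_one hσ)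
    rw [orderOf_eq_one_iff.1 this, one_pow]
  · exact orderOf_dvd_iff_pow_eq_one.1 ((orderOf_dvd_of_pow_eq_one hσ).trans (dvd_coOrder N hst))

theorem eq_one_of_pow_coOrder {G : Type*} [Group G] (hN : OrderSystem H N) {u : G}
    (hu : ∀ τ, u ^ coOrder N τ = 1) : u = 1 := by
  have h0 : orderOf u ∣ N 1 * N 2 := orderOf_dvd_of_pow_eq_one (hu 0)
  have h1 : orderOf u ∣ N 2 * N 0 := orderOf_dvd_of_pow_eq_one (hu 1)
  have h2 : orderOf u ∣ N 0 * N 1 := orderOf_dvd_of_pow_eq_one (hu 2)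
  have c01 := hN.coprime 0 1 (by decide)
  have c02 := hN.coprime 0 2 (by decide)
  have c12 := hN.coprime 1 2 (by decide)
  have d2 : orderOf u ∣ N 2 := by
    have := Nat.dvd_gcd h0 h1
    rwa [mul_comm (N 1), Nat.gcd_mul_left, c01.symm.gcd_eq_one, mul_one] at this
  have := Nat.dvd_gcd d2 h2
  rw [(Nat.Coprime.mul_right c02.symm c12.symm).gcd_eq_one, Nat.dvd_one] at this
  exact orderOf_eq_one_iff.1 this

theorem orderOf_zpow_dvd_orderOf {G : Type*} [Group G] {x : G} (i : ℤ) :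
    orderOf (x ^ i) ∣ orderOf x :=
  orderOf_dvd_of_mem_zpowers (Subgroup.zpow_mem_zpowers x i)

theorem pow_coOrder_of_full (hN : OrderSystem H N) {ι : Type*} {τ : Fin 3} {x y c : ι → H}
    {i j : ℤ} (hc : c * x ^ i * c⁻¹ = y ^ j) {l : ι} (hx : orderOf (x l) = N τ)
    (hy : (orderOf (y l)).Coprime (N τ)) : (x ^ i) ^ coOrder N τ = 1 := by
  have h1 : x l ^ i = 1 := by
    have e : c l * x l ^ i * (c l)⁻¹ = y l ^ j := congrFun hc l
    have d1 : orderOf (x l ^ i) ∣ N τ := hx ▸ orderOf_zpow_dvd_orderOf i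
    have d2 : orderOf (x l ^ i) ∣ orderOf (y l) := by
      have : orderOf (c l * x l ^ i * (c l)⁻¹) = orderOf (x l ^ i) :=
        orderOf_injective (MulAut.conj (c l)).toMonoidHom (MulAut.conj (c l)).injective _
      rw [← this, e]
      exact orderOf_zpow_dvd_orderOf j
    exact orderOf_eq_one_iff.1 (Nat.eq_one_of_dvd_coprimes hy d2 d1)
  have hdvd : (N τ : ℤ) ∣ i := by
    rw [← hx]; exact orderOf_dvd_iff_zpow_eq_one.2 h1
  funext l'
  obtain ⟨σ, hσ⟩ := hN.exists_pow_eq_one (x l')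
  by_cases hst : σ = τ
  · subst hst
    obtain ⟨r, rfl⟩ := hdvd
    simp [zpow_mul, hσ]
  · obtain ⟨r, hr⟩ := dvd_coOrder N hst
    have : (x l' ^ i) ^ coOrder N τ = ((x l') ^ N σ) ^ (i * r) := by
      rw [hr, ← zpow_natCast, ← zpow_natCast, ← zpow_mul, ← zpow_mul]
      congr 1; push_cast; ring
    simpa [hσ] using this

theorem eq_one_of_conj_zpow_eq (hN : OrderSystem H N) {ι : Type*} {x y : ι → H}
    (h : ∀ τ, (∃ l, orderOf (x l) = N τ ∧ (orderOf (y l)).Coprime (N τ)) ∨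
      (∃ l, orderOf (y l) = N τ ∧ (orderOf (x l)).Coprime (N τ)) ∨
      ∀ l, (orderOf (x l)).Coprime (N τ) ∨ (orderOf (y l)).Coprime (N τ))
    {c : ι → H} {i j : ℤ} (hc : c * x ^ i * c⁻¹ = y ^ j) : x ^ i = 1 := by
  refine eq_one_of_pow_coOrder hN fun τ => ?_
  rcases h τ with ⟨l, hl, hl'⟩ | ⟨l, hl, hl'⟩ | hall
  · exact pow_coOrder_of_full hN hc hl hl'
  · have hc' : c⁻¹ * y ^ j * c⁻¹⁻¹ = x ^ i := by rw [← hc]; group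
    have h1 := pow_coOrder_of_full hN hc' hl hl'
    rw [← hc', conj_pow, h1]; simp
  · funext l
    refine pow_coOrder_eq_one hN (h := x l ^ i) ?_
    rcases hall l with h1 | h1
    · exact h1.coprime_dvd_left (orderOf_zpow_dvd_orderOf i)
    · have e : c l * x l ^ i * (c l)⁻¹ = y l ^ j := congrFun hc l
      have : orderOf (c l * x l ^ i * (c l)⁻¹) = orderOf (x l ^ i) :=
        orderOf_injective (MulAut.conj (c l)).toMonoidHom (MulAut.conj (c l)).injective _
      rw [← this, e]
      exact h1.coprime_dvd_left (orderOf_zpow_dvd_orderOf j)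

theorem one_mem_sigmaSet {G : Type*} [Group G] (T : G × G × G) : (1 : G) ∈ SigmaSet T :=
  ⟨1, Or.inl (Or.inl (by simp))⟩

theorem sigmaSet_inter_eq_one {G : Type*} [Group G] (T T' : Fin 3 → G)
    (h : ∀ j j' (c : G) (a b : ℤ), c * T j ^ a * c⁻¹ = T' j' ^ b → T j ^ a = 1) :
    SigmaSet (T 0, T 1, T 2) ∩ SigmaSet (T' 0, T' 1, T' 2) = {1} := by
  refine Set.Subset.antisymm ?_ ?_
  · rintro z ⟨⟨g, hg⟩, ⟨g', hg'⟩⟩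
    have h1 : ∃ j, ∃ a : ℤ, T j ^ a = g * z * g⁻¹ := by
      rcases hg with (⟨a, ha⟩ | ⟨a, ha⟩) | ⟨a, ha⟩
      exacts [⟨0, a, ha⟩, ⟨1, a, ha⟩, ⟨2, a, ha⟩]
    have h2 : ∃ j, ∃ a : ℤ, T' j ^ a = g' * z * g'⁻¹ := by
      rcases hg' with (⟨a, ha⟩ | ⟨a, ha⟩) | ⟨a, ha⟩
      exacts [⟨0, a, ha⟩, ⟨1, a, ha⟩, ⟨2, a, ha⟩]
    obtain ⟨j, a, ha⟩ := h1
    obtain ⟨j', b, hb⟩ := h2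
    have := h j j' (g' * g⁻¹) a b (by rw [ha, hb]; group)
    rw [ha] at this
    simpa using this
  · rintro z rfl
    exact ⟨one_mem_sigmaSet _, one_mem_sigmaSet _⟩

/-- Lower bound for the order of row `j` of a design, given lower bounds `n` for `N`. -/
def rowBound (n : Fin 3 → ℕ) {m : ℕ} (T : Fin m → Fin 3 → Fin 4) (j : Fin 3) : ℕ :=
  if ∃ l l', (T l j : ℕ) < 3 ∧ (T l' j : ℕ) < 3 ∧ T l j ≠ T l' j then 6
  else Finset.univ.sup fun l => if h : (T l j : ℕ) < 3 then n ⟨T l j, h⟩ else 1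

theorem rowBound_le_orderOf (hN : OrderSystem H N) {n : Fin 3 → ℕ} (hn : ∀ τ, n τ ≤ N τ)
    {m k : ℕ} (hmk : m ≤ k) (T : Fin m → Fin 3 → Fin 4) (j : Fin 3) (x : Fin k → H)
    [Finite H] (hx : ∀ l : Fin m, HasCode N (T l j) (x (l.castLE hmk))) :
    rowBound n T j ≤ orderOf x := by
  have hdvd : ∀ l, orderOf (x l) ∣ orderOf x := fun l =>
    orderOf_map_dvd (Pi.evalMonoidHom (fun _ => H) l) x
  have hpos : 0 < orderOf x := orderOf_pos x
  unfold rowBound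
  split_ifs with hmix
  · obtain ⟨l, l', h3, h3', hne⟩ := hmix
    have e := (hasCode_iff_orderOf h3).1 (hx l)
    have e' := (hasCode_iff_orderOf h3').1 (hx l')
    have hcop := hN.coprime ⟨T l j, h3⟩ ⟨T l' j, h3'⟩ (fun h => hne (Fin.ext (by simpa using h)))
    have hd := hcop.mul_dvd_of_dvd_of_dvd (e ▸ hdvd _) (e' ▸ hdvd _)
    have h2 := hN.two_le ⟨T l j, h3⟩
    have h2' := hN.two_le ⟨T l' j, h3'⟩
    refine le_trans ?_ (Nat.le_of_dvd hpos hd)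
    rcases h2.eq_or_lt with h | h
    · rcases h2'.eq_or_lt with h' | h'
      · rw [← h, ← h'] at hcop; exact absurd hcop (by decide)
      · rw [← h]; omega
    · nlinarith
  · refine Finset.sup_le fun l _ => ?_
    split_ifs with h3
    · have e := (hasCode_iff_orderOf h3).1 (hx l)
      exact (hn _).trans (Nat.le_of_dvd hpos (e ▸ hdvd _))
    · exact hpos

theorem isHyperbolic_of_le {G : Type*} [Group G] {a b c : G} {x y z : ℕ}
    (ha : x ≤ orderOf a) (hb : y ≤ orderOf b) (hc : z ≤ orderOf c)
    (h : y * z + x * z + x * y < x * y * z) : IsHyperbolic (a, b, c) := by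
  have hx : 0 < x := by rcases Nat.eq_zero_or_pos x with rfl | h'; · simp at h
                        · exact h'
  have hy : 0 < y := by rcases Nat.eq_zero_or_pos y with rfl | h'; · simp at h
                        · exact h'
  have hz : 0 < z := by rcases Nat.eq_zero_or_pos z with rfl | h'; · simp at h
                        · exact h'
  have e : (x : ℚ)⁻¹ + (y : ℚ)⁻¹ + (z : ℚ)⁻¹ < 1 := by
    have hx' : (0 : ℚ) < x := by exact_mod_cast hx
    have hy' : (0 : ℚ) < y := by exact_mod_cast hy
    have hz' : (0 : ℚ) < z := by exact_mod_cast hz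
    have h' : (y : ℚ) * z + x * z + x * y < x * y * z := by exact_mod_cast h
    have : (x : ℚ)⁻¹ + (y : ℚ)⁻¹ + (z : ℚ)⁻¹ = (y * z + x * z + x * y) / (x * y * z) := by
      field_simp
    rw [this, div_lt_one (by positivity)]
    exact h'
  have f : ∀ {r s : ℕ}, 0 < r → r ≤ s → (s : ℚ)⁻¹ ≤ (r : ℚ)⁻¹ := fun {r s} hr hrs =>
    inv_anti₀ (by exact_mod_cast hr) (by exact_mod_cast hrs)
  exact lt_of_le_of_lt (add_le_add (add_le_add (f hx ha) (f hy hb)) (f hz hc)) e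

/-- A design: two families of columns that combine to a Beauville structure. -/
structure IsDesign (n : Fin 3 → ℕ) {m : ℕ} (T : Fin m → Fin 3 → Fin 4) : Prop where
  clash : ∀ l l', l ≠ l' → ∃ j, CodeClash (T l j) (T l' j)
  hyperbolic : rowBound n T 1 * rowBound n T 2 + rowBound n T 0 * rowBound n T 2 +
    rowBound n T 0 * rowBound n T 1 < rowBound n T 0 * rowBound n T 1 * rowBound n T 2

/-- Some column separates the prime-order part `τ` of row `j` of `T` from row `j'` of `T'`. -/
def RowsSeparated {m : ℕ} (T T' : Fin m → Fin 3 → Fin 4) (j j' τ : Fin 3) : Prop :=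
  ∃ l, ((T l j : ℕ) = τ ∧ CodeOff (T' l j') τ) ∨ ((T' l j' : ℕ) = τ ∧ CodeOff (T l j) τ)

instance {m : ℕ} (T T' : Fin m → Fin 3 → Fin 4) (j j' τ : Fin 3) :
    Decidable (RowsSeparated T T' j j' τ) := by
  unfold RowsSeparated; infer_instance

theorem exists_rows_of_isDesign [IsSimpleGroup H] [Finite H] (hcomm : ∃ x y : H, x * y ≠ y * x)
    (hN : OrderSystem H N) {n : Fin 3 → ℕ} (hn : ∀ τ, n τ ≤ N τ) {m k : ℕ} (hmk : m ≤ k)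
    (hk : k * Nat.card (MulAut H) ≤ phi2 H) {T : Fin m → Fin 3 → Fin 4} (hT : IsDesign n T)
    (hcol : ∀ l, HasColumn H N (T l)) :
    ∃ x : Fin 3 → Fin k → H, IsGenTriple (x 0, x 1, x 2) ∧ IsHyperbolic (x 0, x 1, x 2) ∧
      ∀ (l : Fin m) j, HasCode N (T l j) (x j (l.castLE hmk)) := by
  choose a b c habc hgen ha hb hc using hcol
  obtain ⟨w, hw, hwne, hwv⟩ := exists_extension_inequivalent (phi2 H) rfl
    (fun l => (a l, b l)) hgen (by
      rintro l l' hll ⟨φ, h1, h2⟩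
      have h3 : φ (c l) = c l' := by
        have e1 : c l = (a l * b l)⁻¹ := (inv_eq_of_mul_eq_one_right (habc l)).symm
        have e2 : c l' = (a l' * b l')⁻¹ := (inv_eq_of_mul_eq_one_right (habc l')).symm
        have h1' : φ (a l) = a l' := h1
        have h2' : φ (b l) = b l' := h2
        rw [e1, e2, map_inv, map_mul, h1', h2']
      have ho : ∀ u, orderOf u = orderOf (φ u) := fun u =>
        (orderOf_injective φ.toMonoidHom φ.injective u).symm
      obtain ⟨j, hj⟩ := hT.clash l l' hll
      fin_cases j
      · exact orderOf_ne_of_codeClash hN (ha l) (ha l') hj ((ho _).trans (congrArg _ h1))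
      · exact orderOf_ne_of_codeClash hN (hb l) (hb l') hj ((ho _).trans (congrArg _ h2))
      · exact orderOf_ne_of_codeClash hN (hc l) (hc l') hj ((ho _).trans (congrArg _ h3)))
    hmk hk
  let A : Fin k → H := fun i => (w i).1
  let B : Fin k → H := fun i => (w i).2
  have hAB : Subgroup.closure {A, B} = ⊤ := closure_pair_pi_eq_top hcomm A B hw hwne
  have hcode : ∀ (l : Fin m) j,
      HasCode N (T l j) ((![A, B, (A * B)⁻¹] : Fin 3 → Fin k → H) j (l.castLE hmk)) := by
    intro l j
    have e1 : A (l.castLE hmk) = a l := congrArg Prod.fst (hwv l)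
    have e2 : B (l.castLE hmk) = b l := congrArg Prod.snd (hwv l)
    fin_cases j
    · simpa [e1] using ha l
    · simpa [e2] using hb l
    · have : ((A * B)⁻¹) (l.castLE hmk) = c l := by
        simp only [Pi.inv_apply, Pi.mul_apply, e1, e2]
        exact inv_eq_of_mul_eq_one_right (habc l)
      change HasCode N (T l 2) (((A * B)⁻¹) (l.castLE hmk))
      rw [this]; exact hc l
  refine ⟨![A, B, (A * B)⁻¹], ⟨?_, ?_⟩, ?_, hcode⟩
  · simp
  · rw [eq_top_iff, ← hAB]
    exact Subgroup.closure_mono (by intro z; simp only [Set.mem_insert_iff]; tauto)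
  · exact isHyperbolic_of_le
      (rowBound_le_orderOf hN hn hmk T 0 _ fun l => hcode l 0)
      (rowBound_le_orderOf hN hn hmk T 1 _ fun l => hcode l 1)
      (rowBound_le_orderOf hN hn hmk T 2 _ fun l => hcode l 2) hT.hyperbolic

theorem hasBeauvilleStructure_of_designs [IsSimpleGroup H] [Finite H]
    (hcomm : ∃ x y : H, x * y ≠ y * x)
    (hN : OrderSystem H N) {n : Fin 3 → ℕ} (hn : ∀ τ, n τ ≤ N τ) {m k : ℕ} (hmk : m ≤ k)
    (hk : k * Nat.card (MulAut H) ≤ phi2 H) {T T' : Fin m → Fin 3 → Fin 4}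
    (hT : IsDesign n T) (hT' : IsDesign n T')
    (hcol : ∀ l, HasColumn H N (T l)) (hcol' : ∀ l, HasColumn H N (T' l))
    (hsep : ∀ j j' τ, RowsSeparated T T' j j' τ ∨
      (k = m ∧ ∀ l, CodeOff (T l j) τ ∨ CodeOff (T' l j') τ)) :
    HasBeauvilleStructure (Fin k → H) := by
  obtain ⟨x, hx1, hx2, hx3⟩ := exists_rows_of_isDesign hcomm hN hn hmk hk hT hcol
  obtain ⟨y, hy1, hy2, hy3⟩ := exists_rows_of_isDesign hcomm hN hn hmk hk hT' hcol'
  refine ⟨_, _, hx1, hx2, hy1, hy2, sigmaSet_inter_eq_one x y fun j j' c a b h => ?_⟩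
  refine eq_one_of_conj_zpow_eq hN (fun τ => ?_) h
  have full : ∀ {e : Fin 4} {u : H}, HasCode N e u → (e : ℕ) = τ → orderOf u = N τ := by
    intro e u hu he
    have h3 : (e : ℕ) < 3 := he ▸ τ.2
    rw [(hasCode_iff_orderOf h3).1 hu]
    exact congrArg N (Fin.ext he)
  rcases hsep j j' τ with ⟨l, ⟨h1, h2⟩ | ⟨h1, h2⟩⟩ | ⟨rfl, hall⟩
  · exact Or.inl ⟨_, full (hx3 l j) h1, coprime_of_codeOff hN (hy3 l j') h2⟩
  · exact Or.inr (Or.inl ⟨_, full (hy3 l j') h1, coprime_of_codeOff hN (hx3 l j) h2⟩)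
  · refine Or.inr (Or.inr fun l => ?_)
    rcases hall l with h1 | h1
    · exact Or.inl (coprime_of_codeOff hN (hx3 l j) h1)
    · exact Or.inr (coprime_of_codeOff hN (hy3 l j') h1)

theorem HasColumn.rotate {x y z : Fin 4} (h : HasColumn H N ![x, y, z]) :
    HasColumn H N ![y, z, x] := by
  obtain ⟨a, b, c, habc, hgen, ha, hb, hc⟩ := h
  refine ⟨b, c, a, ?_, ?_, hb, hc, ha⟩
  · have : b * c = a⁻¹ := eq_inv_of_mul_eq_one_right (by rw [← mul_assoc, habc])
    rw [this, inv_mul_cancel]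
  · rw [eq_top_iff, ← hgen, Subgroup.closure_le]
    have hb' : b ∈ Subgroup.closure {b, c} := Subgroup.subset_closure (by simp)
    have hc' : c ∈ Subgroup.closure {b, c} := Subgroup.subset_closure (by simp)
    rintro u (rfl | rfl)
    · have : u = (b * c)⁻¹ := eq_inv_of_mul_eq_one_left (by rw [← mul_assoc, habc])
      rw [this]
      exact Subgroup.inv_mem _ (Subgroup.mul_mem _ hb' hc')
    · exact hb'

theorem HasColumn.swap {x y z : Fin 4} (h : HasColumn H N ![x, y, z]) :
    HasColumn H N ![y, x, z] := by
  obtain ⟨a, b, c, habc, hgen, ha, hb, hc⟩ := h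
  refine ⟨b, b⁻¹ * a * b, c, ?_, ?_, hb, ?_, hc⟩
  · rw [← habc]; group
  · rw [eq_top_iff, ← hgen, Subgroup.closure_le]
    have hb' : b ∈ Subgroup.closure {b, b⁻¹ * a * b} := Subgroup.subset_closure (by simp)
    have hc' : b⁻¹ * a * b ∈ Subgroup.closure {b, b⁻¹ * a * b} :=
      Subgroup.subset_closure (by simp)
    rintro u (rfl | rfl)
    · have := Subgroup.mul_mem _ (Subgroup.mul_mem _ hb' hc') (Subgroup.inv_mem _ hb')
      have e : b * (b⁻¹ * u * b) * b⁻¹ = u := by group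
      rwa [e] at this
    · exact hb'
  · have e : orderOf (b⁻¹ * a * b) = orderOf a := by
      have := orderOf_injective (MulAut.conj b⁻¹).toMonoidHom (MulAut.conj b⁻¹).injective a
      simpa using this
    show HasCode N x _
    have ha' : HasCode N x a := ha
    unfold HasCode at ha' ⊢
    rwa [e]

end Codes

section Designs

variable {H : Type*} [Group H] [IsSimpleGroup H] [Finite H] {N : Fin 3 → ℕ}

theorem beauville_of_four_le (hcomm : ∃ x y : H, x * y ≠ y * x)
    (hN : OrderSystem H N) {k : ℕ} (hmk : 4 ≤ k)
    (hk : k * Nat.card (MulAut H) ≤ phi2 H) (Z : HasColumn H N ![0, 1, 2]) :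
    HasBeauvilleStructure (Fin k → H) := by
  refine hasBeauvilleStructure_of_designs hcomm hN (n := ![2, 2, 2])
    (fun τ => by fin_cases τ <;> exact hN.two_le _) hmk hk
    (T := ![![0, 2, 1], ![0, 1, 2], ![2, 0, 1], ![2, 1, 0]])
    (T' := ![![0, 2, 1], ![2, 0, 1], ![2, 1, 0], ![1, 2, 0]])
    ⟨by decide, by decide⟩ ⟨by decide, by decide⟩ ?_ ?_ (fun j j' τ => Or.inl ?_)
  · intro l; fin_cases l
    exacts [Z.swap.rotate, Z, Z.rotate.rotate, Z.swap.rotate.rotate]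
  · intro l; fin_cases l
    exacts [Z.swap.rotate, Z.rotate.rotate, Z.swap.rotate.rotate, Z.rotate]
  · revert j j' τ; decide

theorem beauville_three_odd (hcomm : ∃ x y : H, x * y ≠ y * x)
    (hN : OrderSystem H N) (hk : 3 * Nat.card (MulAut H) ≤ phi2 H) (h2 : 3 ≤ N 2)
    (Z : HasColumn H N ![0, 1, 2]) (P : HasColumn H N ![0, 2, 2]) :
    HasBeauvilleStructure (Fin 3 → H) := by
  refine hasBeauvilleStructure_of_designs hcomm hN (n := ![2, 2, 3])
    (fun τ => by fin_cases τ; exacts [hN.two_le _, hN.two_le _, h2]) le_rfl hk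
    (T := ![![0, 2, 2], ![0, 2, 1], ![0, 1, 2]])
    (T' := ![![0, 2, 1], ![0, 2, 2], ![2, 2, 0]])
    ⟨by decide, by decide⟩ ⟨by decide, by decide⟩ ?_ ?_ (fun j j' τ => ?_)
  · intro l; fin_cases l
    exacts [P, Z.swap.rotate, Z]
  · intro l; fin_cases l
    exacts [Z.swap.rotate, P, P.rotate]
  · revert j j' τ; decide

theorem beauville_three_even (hcomm : ∃ x y : H, x * y ≠ y * x)
    (hN : OrderSystem H N) (hk : 3 * Nat.card (MulAut H) ≤ phi2 H) (h0 : 3 ≤ N 0) (h1 : 3 ≤ N 1)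
    (Z : HasColumn H N ![0, 1, 2]) (W : HasColumn H N ![0, 0, 1]) :
    HasBeauvilleStructure (Fin 3 → H) := by
  refine hasBeauvilleStructure_of_designs hcomm hN (n := ![3, 3, 2])
    (fun τ => by fin_cases τ; exacts [h0, h1, hN.two_le _]) le_rfl hk
    (T := ![![0, 0, 1], ![0, 2, 1], ![0, 1, 0]])
    (T' := ![![0, 0, 1], ![0, 1, 0], ![2, 0, 1]])
    ⟨by decide, by decide⟩ ⟨by decide, by decide⟩ ?_ ?_ (fun j j' τ => ?_)
  · intro l; fin_cases l
    exacts [W, Z.swap.rotate, W.rotate]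
  · intro l; fin_cases l
    exacts [W, W.rotate, Z.rotate.rotate]
  · revert j j' τ; decide

theorem beauville_two_odd (hcomm : ∃ x y : H, x * y ≠ y * x)
    (hN : OrderSystem H N) (hk : 2 * Nat.card (MulAut H) ≤ phi2 H) (h0 : 3 ≤ N 0) (h2 : 3 ≤ N 2)
    (Z : HasColumn H N ![0, 1, 2]) (P : HasColumn H N ![0, 2, 2])
    (G : HasColumn H N ![3, 0, 1]) :
    HasBeauvilleStructure (Fin 2 → H) := by
  refine hasBeauvilleStructure_of_designs hcomm hN (n := ![3, 2, 3])
    (fun τ => by fin_cases τ; exacts [h0, hN.two_le _, h2]) le_rfl hk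
    (T := ![![3, 0, 1], ![2, 2, 0]]) (T' := ![![0, 2, 2], ![0, 2, 1]])
    ⟨by decide, by decide⟩ ⟨by decide, by decide⟩ ?_ ?_ (fun j j' τ => ?_)
  · intro l; fin_cases l
    exacts [G, P.rotate]
  · intro l; fin_cases l
    exacts [P, Z.swap.rotate]
  · revert j j' τ; decide

theorem beauville_two_even (hcomm : ∃ x y : H, x * y ≠ y * x)
    (hN : OrderSystem H N) (hk : 2 * Nat.card (MulAut H) ≤ phi2 H) (h0 : 3 ≤ N 0) (h1 : 3 ≤ N 1)
    (Z : HasColumn H N ![0, 1, 2]) (W : HasColumn H N ![0, 0, 1])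
    (V : HasColumn H N ![0, 0, 2]) (U : HasColumn H N ![0, 1, 1]) :
    HasBeauvilleStructure (Fin 2 → H) := by
  refine hasBeauvilleStructure_of_designs hcomm hN (n := ![3, 3, 2])
    (fun τ => by fin_cases τ; exacts [h0, h1, hN.two_le _]) le_rfl hk
    (T := ![![0, 0, 2], ![0, 0, 1]]) (T' := ![![0, 1, 1], ![2, 0, 1]])
    ⟨by decide, by decide⟩ ⟨by decide, by decide⟩ ?_ ?_ (fun j j' τ => ?_)
  · intro l; fin_cases l
    exacts [V, W]
  · intro l; fin_cases l
    exacts [U, Z.rotate.rotate]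
  · revert j j' τ; decide

theorem beauville_two_four (hcomm : ∃ x y : H, x * y ≠ y * x)
    (hN : OrderSystem H N) (hk : 2 * Nat.card (MulAut H) ≤ phi2 H) (h0 : 3 ≤ N 0) (h1 : 5 ≤ N 1)
    (Z : HasColumn H N ![0, 1, 2]) (W : HasColumn H N ![0, 0, 1])
    (V : HasColumn H N ![1, 1, 2]) :
    HasBeauvilleStructure (Fin 2 → H) := by
  refine hasBeauvilleStructure_of_designs hcomm hN (n := ![3, 5, 2])
    (fun τ => by fin_cases τ; exacts [h0, h1, hN.two_le _]) le_rfl hk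
    (T := ![![0, 0, 1], ![0, 2, 1]]) (T' := ![![1, 1, 2], ![0, 0, 1]])
    ⟨by decide, by decide⟩ ⟨by decide, by decide⟩ ?_ ?_ (fun j j' τ => ?_)
  · intro l; fin_cases l
    exacts [W, Z.swap.rotate]
  · intro l; fin_cases l
    exacts [V, W]
  · revert j j' τ; decide

theorem beauville_two_five (hcomm : ∃ x y : H, x * y ≠ y * x)
    (hN : OrderSystem H N) (hk : 2 * Nat.card (MulAut H) ≤ phi2 H) (h1 : 3 ≤ N 1) (h2 : 5 ≤ N 2)
    (Z : HasColumn H N ![0, 1, 2]) (P : HasColumn H N ![0, 2, 2])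
    (V : HasColumn H N ![1, 1, 2]) :
    HasBeauvilleStructure (Fin 2 → H) := by
  refine hasBeauvilleStructure_of_designs hcomm hN (n := ![2, 3, 5])
    (fun τ => by fin_cases τ; exacts [hN.two_le _, h1, h2]) le_rfl hk
    (T := ![![1, 1, 2], ![1, 0, 2]]) (T' := ![![2, 2, 0], ![1, 1, 2]])
    ⟨by decide, by decide⟩ ⟨by decide, by decide⟩ ?_ ?_ (fun j j' τ => ?_)
  · intro l; fin_cases l
    exacts [V, Z.swap]
  · intro l; fin_cases l
    exacts [P.rotate, V]
  · revert j j' τ; decide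

end Designs

section Orders

variable {F : Type*} [Field F]

theorem orderOf_eq_of_pow_iff {G : Type*} [Monoid G] {x : G} {n : ℕ}
    (h : ∀ m : ℕ, x ^ m = 1 ↔ n ∣ m) : orderOf x = n :=
  Nat.dvd_antisymm (orderOf_dvd_of_pow_eq_one ((h n).2 dvd_rfl))
    ((h _).1 (pow_orderOf_eq_one x))

theorem det_entries (M : SL(2, F)) : M 0 0 * M 1 1 - M 0 1 * M 1 0 = 1 := by
  have := M.det_coe
  rwa [Matrix.det_fin_two] at this

/-- The image of `M` in `PSL(2, F)`. -/
abbrev toPSL (M : SL(2, F)) : PSL(2, F) :=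
  QuotientGroup.mk' (Subgroup.center SL(2, F)) M

theorem toPSL_eq_one_iff (M : SL(2, F)) :
    toPSL M = 1 ↔ M 0 1 = 0 ∧ M 1 0 = 0 ∧ M 0 0 = M 1 1 := by
  rw [toPSL, QuotientGroup.mk'_apply, QuotientGroup.eq_one_iff,
    Matrix.SpecialLinearGroup.mem_center_iff]
  constructor
  · rintro ⟨r, -, hr⟩
    simp [← hr]
  · rintro ⟨h1, h2, h3⟩
    refine ⟨M 0 0, ?_, ?_⟩
    · have := det_entries M
      rw [h1, ← h3] at this
      simp only [Fintype.card_fin]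
      linear_combination this
    · ext i j
      fin_cases i <;> fin_cases j <;> simp [h1, h2, h3]

theorem pow_sub_smul_eq {E : Type*} [Field E] {A : Matrix (Fin 2) (Fin 2) E} {x y : E}
    (hxy : x * y = 1) (hA : A * A = (x + y) • A - 1) (n : ℕ) :
    (x - y) • A ^ n = (x ^ n - y ^ n) • A - (x ^ n * y - y ^ n * x) • 1 := by
  induction n with
  | zero => simp [← neg_smul]
  | succ n ih =>
    rw [pow_succ, ← smul_mul_assoc, ih, sub_mul, smul_mul_assoc, hA, smul_mul_assoc, one_mul]
    have e : x ^ (n + 1) * y - y ^ (n + 1) * x = x ^ n - y ^ n := by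
      linear_combination (x ^ n - y ^ n) * hxy
    rw [e]
    module

theorem mul_self_eq (M : SL(2, F)) {τ : F} (hτ : M 0 0 + M 1 1 = τ) :
    (M : Matrix (Fin 2) (Fin 2) F) * (M : Matrix (Fin 2) (Fin 2) F) =
      τ • (M : Matrix (Fin 2) (Fin 2) F) - 1 := by
  have := det_entries M
  ext i j
  subst hτ
  fin_cases i <;> fin_cases j <;> simp [Matrix.mul_apply] <;>
    first | ring1 | linear_combination -this

theorem toPSL_pow_eq_one_iff {E : Type*} [Field E] (f : F →+* E) {M : SL(2, F)} {x : E}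
    (hx0 : x ≠ 0) (hx2 : x ^ 2 ≠ 1) (htr : f (M 0 0 + M 1 1) = x + x⁻¹) (n : ℕ) :
    toPSL M ^ n = 1 ↔ (x ^ 2) ^ n = 1 := by
  have hxy : x * x⁻¹ = 1 := mul_inv_cancel₀ hx0
  have hne : x - x⁻¹ ≠ 0 := fun h => hx2 (by linear_combination x * h + hxy)
  set A : Matrix (Fin 2) (Fin 2) E := (M : Matrix (Fin 2) (Fin 2) F).map f with hA
  have hAA : A * A = (x + x⁻¹) • A - 1 := by
    have := congrArg f.mapMatrix (mul_self_eq M rfl)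
    rw [map_mul, map_sub, map_one] at this
    rw [← htr]
    refine this.trans ?_
    congr 1
    ext i j
    simp [hA]
  have hpow := pow_sub_smul_eq hxy hAA n
  have hAn : A ^ n = ((M ^ n : SL(2, F)) : Matrix (Fin 2) (Fin 2) F).map f := by
    rw [hA, Matrix.SpecialLinearGroup.coe_pow]
    exact (map_pow f.mapMatrix _ n).symm
  rw [hAn] at hpow
  have entry : ∀ i j, (x - x⁻¹) * f ((M ^ n) i j) = (x ^ n - x⁻¹ ^ n) * f (M i j) -
      (x ^ n * x⁻¹ - x⁻¹ ^ n * x) * (1 : Matrix (Fin 2) (Fin 2) E) i j := fun i j => by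
    simpa [hA] using congrFun (congrFun hpow i) j
  have h00 := entry 0 0
  have h11 := entry 1 1
  have h01 := entry 0 1
  have h10 := entry 1 0
  simp only [Matrix.one_apply_eq, mul_one, ne_eq, zero_ne_one, one_ne_zero, not_false_eq_true,
    Matrix.one_apply_ne, mul_zero, sub_zero] at h00 h11 h01 h10
  have hpw : (x ^ 2) ^ n = 1 ↔ x ^ n - x⁻¹ ^ n = 0 := by
    have e : x ^ n * x⁻¹ ^ n = 1 := by rw [← mul_pow, hxy, one_pow]
    have hxn : x ^ n ≠ 0 := pow_ne_zero _ hx0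
    rw [← pow_mul, mul_comm, pow_mul]
    constructor
    · intro h
      have : x ^ n * (x ^ n - x⁻¹ ^ n) = 0 := by linear_combination h - e
      exact (mul_eq_zero.1 this).resolve_left hxn
    · intro h
      linear_combination x ^ n * h + e
  rw [hpw, ← map_pow, toPSL_eq_one_iff]
  constructor
  · rintro ⟨e1, e2, e3⟩
    rw [e1, map_zero, mul_zero] at h01
    rw [e2, map_zero, mul_zero] at h10
    by_contra hd
    have f1 : f (M 0 1) = 0 := (mul_eq_zero.1 h01.symm).resolve_left hd
    have f3 : f (M 0 0) - f (M 1 1) = 0 := by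
      have : (x ^ n - x⁻¹ ^ n) * (f (M 0 0) - f (M 1 1)) = 0 := by
        rw [e3] at h00
        linear_combination h11 - h00
      exact (mul_eq_zero.1 this).resolve_left hd
    have hdet := congrArg f (det_entries M)
    simp only [map_sub, map_mul, map_one, f1, zero_mul, sub_zero] at hdet
    rw [map_add] at htr
    have : (x - x⁻¹) ^ 2 = 0 := by
      have e1 : f (M 0 0) = f (M 1 1) := sub_eq_zero.1 f3
      rw [e1] at hdet htr
      linear_combination -(x + x⁻¹ + (f (M 1 1) + f (M 1 1))) * htr + 4 * hdet - 4 * hxy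
    exact hne (pow_eq_zero_iff two_ne_zero |>.1 this)
  · intro h
    rw [h, zero_mul] at h01 h10
    refine ⟨?_, ?_, ?_⟩
    · exact (map_eq_zero f).1 ((mul_eq_zero.1 h01).resolve_left hne)
    · exact (map_eq_zero f).1 ((mul_eq_zero.1 h10).resolve_left hne)
    · apply f.injective
      apply mul_left_cancel₀ hne
      rw [h00, h11, h]
      ring

theorem orderOf_toPSL {E : Type*} [Field E] (f : F →+* E) {M : SL(2, F)} {x : E}
    (hx0 : x ≠ 0) (hx2 : x ^ 2 ≠ 1) (htr : f (M 0 0 + M 1 1) = x + x⁻¹) :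
    orderOf (toPSL M) = orderOf (x ^ 2) :=
  orderOf_eq_of_pow_iff fun n => by
    rw [toPSL_pow_eq_one_iff f hx0 hx2 htr, orderOf_dvd_iff_pow_eq_one]

theorem pow_eq_of_mul_self {A : Matrix (Fin 2) (Fin 2) F} {e : F}
    (he : e * e = 1) (hA : A * A = (2 * e) • A - 1) (n : ℕ) :
    A ^ n = (n * e ^ (n + 1)) • A - ((n - 1) * e ^ n) • 1 := by
  induction n with
  | zero => simp
  | succ n ih =>
    rw [pow_succ, ih, sub_mul, smul_mul_assoc, hA, smul_mul_assoc, one_mul]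
    have e1 : e ^ (n + 1 + 1) = e ^ n := by rw [pow_succ, pow_succ, mul_assoc, he, mul_one]
    have e2 : e ^ (n + 1) = e ^ n * e := pow_succ e n
    rw [e1]
    have e3 : (n * e ^ (n + 1)) * (2 * e) = 2 * n * e ^ n := by
      rw [e2]; linear_combination 2 * n * e ^ n * he
    rw [smul_sub, smul_smul, e3]
    push_cast
    module

theorem orderOf_toPSL_unipotent (p : ℕ) [CharP F p] {M : SL(2, F)} {e : F} (he : e * e = 1)
    (htr : M 0 0 + M 1 1 = 2 * e) (hM : toPSL M ≠ 1) : orderOf (toPSL M) = p := by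
  refine orderOf_eq_of_pow_iff fun n => ?_
  have hpow := pow_eq_of_mul_self he (mul_self_eq M htr) n
  rw [← Matrix.SpecialLinearGroup.coe_pow] at hpow
  have entry : ∀ i j, (M ^ n) i j = n * e ^ (n + 1) * M i j -
      ((n - 1) * e ^ n) * (1 : Matrix (Fin 2) (Fin 2) F) i j := fun i j => by
    simpa using congrFun (congrFun hpow i) j
  have h00 := entry 0 0
  have h11 := entry 1 1
  have h01 := entry 0 1
  have h10 := entry 1 0
  simp only [Matrix.one_apply_eq, mul_one, ne_eq, zero_ne_one, one_ne_zero, not_false_eq_true,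
    Matrix.one_apply_ne, mul_zero, sub_zero] at h00 h11 h01 h10
  have he0 : e ≠ 0 := by rintro rfl; simp at he
  rw [← CharP.cast_eq_zero_iff F p n, ← map_pow, toPSL_eq_one_iff]
  constructor
  · rintro ⟨e1, e2, e3⟩
    by_contra hn
    apply hM
    have hne : (n : F) * e ^ (n + 1) ≠ 0 := mul_ne_zero hn (pow_ne_zero _ he0)
    rw [toPSL_eq_one_iff]
    rw [h01] at e1
    rw [h10] at e2
    refine ⟨(mul_eq_zero.1 e1).resolve_left hne, (mul_eq_zero.1 e2).resolve_left hne, ?_⟩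
    apply mul_left_cancel₀ hne
    linear_combination e3 - h00 + h11
  · intro hn
    rw [h01, h10, h00, h11, hn]
    simp

variable (F) in
theorem exists_eq_add_inv (τ : F) : ∃ x : AlgebraicClosure F, x ≠ 0 ∧
    x ^ 2 - algebraMap F _ τ * x + 1 = 0 ∧ algebraMap F _ τ = x + x⁻¹ := by
  obtain ⟨x, hx⟩ := IsAlgClosed.exists_root (k := AlgebraicClosure F)
    (Polynomial.X ^ 2 - Polynomial.C (algebraMap F _ τ) * Polynomial.X + 1) (by
      have : (Polynomial.X ^ 2 - Polynomial.C (algebraMap F (AlgebraicClosure F) τ) *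
          Polynomial.X + 1).degree = 2 := by compute_degree!
      rw [this]; norm_num)
  simp only [Polynomial.IsRoot.def, Polynomial.eval_add, Polynomial.eval_sub,
    Polynomial.eval_pow, Polynomial.eval_X, Polynomial.eval_mul, Polynomial.eval_C,
    Polynomial.eval_one] at hx
  have hx0 : x ≠ 0 := by rintro rfl; simp at hx
  refine ⟨x, hx0, hx, mul_right_cancel₀ hx0 ?_⟩
  rw [add_mul, inv_mul_cancel₀ hx0]
  linear_combination -hx

end Orders

section FiniteOrders

variable (F : Type*) [Field F] [Fintype F]

/-- The three types of element orders in `PSL(2, F)`: split, nonsplit and unipotent. -/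
noncomputable def pslOrders : Fin 3 → ℕ :=
  ![(Fintype.card F - 1) / Nat.gcd (Fintype.card F - 1) 2,
    (Fintype.card F + 1) / Nat.gcd (Fintype.card F + 1) 2, ringChar F]

theorem exists_card_eq_ringChar_pow :
    ∃ n : ℕ, (ringChar F).Prime ∧ 0 < n ∧ Fintype.card F = ringChar F ^ n := by
  obtain ⟨n, h1, h2⟩ := FiniteField.card F (ringChar F)
  exact ⟨n, h1, n.2, h2⟩

theorem pslOrders_arith {q p n : ℕ} (hn : 0 < n) (hq : q = p ^ n) (h4 : 4 ≤ q) :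
    2 ≤ (q - 1) / Nat.gcd (q - 1) 2 ∧ 2 ≤ (q + 1) / Nat.gcd (q + 1) 2 ∧
    Nat.Coprime ((q - 1) / Nat.gcd (q - 1) 2) ((q + 1) / Nat.gcd (q + 1) 2) ∧
    Nat.Coprime ((q - 1) / Nat.gcd (q - 1) 2) p ∧
    Nat.Coprime ((q + 1) / Nat.gcd (q + 1) 2) p := by
  have hpq : p ∣ q := hq ▸ dvd_pow_self p hn.ne'
  have c1 : Nat.Coprime (q - 1) p := by
    refine Nat.Coprime.coprime_dvd_right hpq ?_
    have : Nat.Coprime (q - 1) (q - 1 + 1) := by simp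
    rwa [Nat.sub_add_cancel (by omega)] at this
  have c2 : Nat.Coprime (q + 1) p := by
    refine Nat.Coprime.coprime_dvd_right hpq ?_
    simp
  refine ⟨?_, ?_, ?_, c1.coprime_dvd_left (Nat.div_dvd_of_dvd (Nat.gcd_dvd_left _ _)),
    c2.coprime_dvd_left (Nat.div_dvd_of_dvd (Nat.gcd_dvd_left _ _))⟩
  all_goals
    rcases Nat.even_or_odd' q with ⟨r, rfl | rfl⟩
  · have : Nat.gcd (2 * r - 1) 2 = 1 := by
      rw [← Nat.coprime_iff_gcd_eq_one, Nat.coprime_two_right, Nat.odd_iff]; omega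
    rw [this]; omega
  · have : Nat.gcd (2 * r + 1 - 1) 2 = 2 := by simp
    rw [this]; omega
  · have : Nat.gcd (2 * r + 1) 2 = 1 := by simp
    rw [this]; omega
  · have : Nat.gcd (2 * r + 1 + 1) 2 = 2 := Nat.gcd_eq_right (by omega)
    rw [this]; omega
  · have e1 : Nat.gcd (2 * r - 1) 2 = 1 := by
      rw [← Nat.coprime_iff_gcd_eq_one, Nat.coprime_two_right, Nat.odd_iff]; omega
    have e2 : Nat.gcd (2 * r + 1) 2 = 1 := by simp
    rw [e1, e2, Nat.div_one, Nat.div_one]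
    have : 2 * r + 1 = 2 + (2 * r - 1) := by omega
    rw [this, Nat.coprime_add_self_right]
    exact e1
  · have e1 : Nat.gcd (2 * r + 1 - 1) 2 = 2 := by simp
    have e2 : Nat.gcd (2 * r + 1 + 1) 2 = 2 := Nat.gcd_eq_right (by omega)
    have e3 : (2 * r + 1 - 1) / 2 = r := by omega
    have e4 : (2 * r + 1 + 1) / 2 = r + 1 := by omega
    rw [e1, e2, e3, e4]; simp

variable {F}

theorem dvd_div_gcd_two_of_pow {E : Type*} [Field E] {x : E} {n : ℕ} (hn : x ^ n = 1) :
    (x ^ 2) ^ (n / Nat.gcd n 2) = 1 := by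
  rw [← pow_mul]
  have : n ∣ 2 * (n / n.gcd 2) := by
    obtain ⟨r, hr⟩ := Nat.gcd_dvd_right n 2
    obtain ⟨s, hs⟩ := Nat.gcd_dvd_left n 2
    have hpos : 0 < n.gcd 2 := Nat.gcd_pos_of_pos_right _ (by norm_num)
    have e : n / n.gcd 2 = s := Nat.div_eq_of_eq_mul_right hpos hs
    rw [e]
    refine ⟨r, ?_⟩
    calc 2 * s = (n.gcd 2 * r) * s := by rw [← hr]
      _ = (n.gcd 2 * s) * r := by ring
      _ = n * r := by rw [← hs]
  obtain ⟨r, hr⟩ := this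
  rw [hr, pow_mul, hn, one_pow]

theorem pow_card_eq_or_inv {E : Type*} [Field E] [Algebra F E] {x : E} {τ : F}
    (hx : x ^ 2 - algebraMap F E τ * x + 1 = 0) :
    x ^ (Fintype.card F - 1) = 1 ∨ x ^ (Fintype.card F + 1) = 1 := by
  obtain ⟨n, hp, hn, hq⟩ := exists_card_eq_ringChar_pow F
  have hE : CharP E (ringChar F) := charP_of_injective_algebraMap (algebraMap F E).injective _
  have : ExpChar E (ringChar F) := ExpChar.prime hp
  have hx0 : x ≠ 0 := by rintro rfl; simp at hx
  have hq1 : 0 < Fintype.card F := Fintype.card_pos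
  have hfr : (x ^ Fintype.card F) ^ 2 - algebraMap F E τ * x ^ Fintype.card F + 1 = 0 := by
    have := congrArg (iterateFrobenius E (ringChar F) n) hx
    simp only [map_add, map_sub, map_mul, map_pow, map_one, map_zero, iterateFrobenius_def,
      ← hq] at this
    rwa [← map_pow, FiniteField.pow_card] at this
  set y := x ^ Fintype.card F with hy
  have : (y - x) * (y * x - 1) = 0 := by
    linear_combination x * hfr - y * hx
  rcases mul_eq_zero.1 this with h | h
  · left
    apply mul_right_cancel₀ hx0
    rw [← pow_succ, Nat.sub_add_cancel hq1, one_mul]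
    exact sub_eq_zero.1 h
  · right
    rw [pow_succ]
    exact sub_eq_zero.1 h

theorem orderSystem_pslOrders (hF : 4 ≤ Fintype.card F) :
    OrderSystem PSL(2, F) (pslOrders F) := by
  obtain ⟨n, hp, hn, hq⟩ := exists_card_eq_ringChar_pow F
  obtain ⟨h0, h1, h01, h02, h12⟩ := pslOrders_arith hn hq hF
  refine ⟨fun τ => by fin_cases τ; exacts [h0, h1, hp.two_le], fun σ τ hst => ?_, fun h => ?_⟩
  · fin_cases σ <;> fin_cases τ
    exacts [absurd rfl hst, h01, h02, h01.symm, absurd rfl hst, h12, h02.symm, h12.symm,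
      absurd rfl hst]
  · obtain ⟨M, rfl⟩ := QuotientGroup.mk'_surjective _ h
    obtain ⟨x, hx0, hx, htr⟩ := exists_eq_add_inv F (M 0 0 + M 1 1)
    by_cases hx2 : x ^ 2 = 1
    · refine ⟨2, ?_⟩
      have hinv : x⁻¹ = x := by
        apply mul_left_cancel₀ hx0
        rw [mul_inv_cancel₀ hx0, ← hx2, sq]
      by_cases hM : toPSL M = 1
      · exact (congrArg (· ^ _) hM).trans (one_pow _)
      · have hone : x = 1 ∨ x = -1 := sq_eq_one_iff.1 hx2
        have hex : ∃ e : F, e * e = 1 ∧ M 0 0 + M 1 1 = 2 * e := by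
          rcases hone with rfl | rfl
          · refine ⟨1, by ring, (algebraMap F (AlgebraicClosure F)).injective ?_⟩
            rw [htr, map_mul, map_ofNat, map_one]; norm_num
          · refine ⟨-1, by ring, (algebraMap F (AlgebraicClosure F)).injective ?_⟩
            rw [htr, hinv, map_mul, map_ofNat, map_neg, map_one]; norm_num
        obtain ⟨e, he, htr'⟩ := hex
        have := orderOf_toPSL_unipotent (ringChar F) he htr' hM
        have h2 : pslOrders F 2 = orderOf (toPSL M) := this.symm
        rw [h2]
        exact pow_orderOf_eq_one _
    · rcases pow_card_eq_or_inv hx with h | h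
      · exact ⟨0, (toPSL_pow_eq_one_iff (algebraMap F _) hx0 hx2 htr _).2
          (dvd_div_gcd_two_of_pow h)⟩
      · exact ⟨1, (toPSL_pow_eq_one_iff (algebraMap F _) hx0 hx2 htr _).2
          (dvd_div_gcd_two_of_pow h)⟩

theorem orderOf_toPSL_coprime (hF : 4 ≤ Fintype.card F) {M : SL(2, F)}
    (htr : (M 0 0 + M 1 1) ^ 2 ≠ 4) : (orderOf (toPSL M)).Coprime (pslOrders F 2) := by
  have hN := orderSystem_pslOrders hF
  obtain ⟨x, hx0, hx, hxtr⟩ := exists_eq_add_inv F (M 0 0 + M 1 1)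
  have hx2 : x ^ 2 ≠ 1 := fun hx2 => htr (by
    apply (algebraMap F (AlgebraicClosure F)).injective
    have hinv : x⁻¹ = x := by
      apply mul_left_cancel₀ hx0
      rw [mul_inv_cancel₀ hx0, ← hx2, sq]
    rw [map_pow, hxtr, hinv, map_ofNat]
    linear_combination 4 * hx2)
  rcases pow_card_eq_or_inv hx with h | h
  · exact (hN.coprime 0 2 (by decide)).coprime_dvd_left (orderOf_dvd_of_pow_eq_one
      ((toPSL_pow_eq_one_iff (algebraMap F _) hx0 hx2 hxtr _).2 (dvd_div_gcd_two_of_pow h)))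
  · exact (hN.coprime 1 2 (by decide)).coprime_dvd_left (orderOf_dvd_of_pow_eq_one
      ((toPSL_pow_eq_one_iff (algebraMap F _) hx0 hx2 hxtr _).2 (dvd_div_gcd_two_of_pow h)))

end FiniteOrders

section Generation

variable {F : Type*} [Field F]

/-- The element of `SL(2, F)` with rows `(a, b)` and `(c, d)`. -/
def sl2 (a b c d : F) (h : a * d - b * c = 1) : SL(2, F) :=
  ⟨!![a, b; c, d], by rw [Matrix.det_fin_two_of]; exact h⟩

@[simp] theorem sl2_apply (a b c d : F) (h : a * d - b * c = 1) :
    (sl2 a b c d h) 0 0 = a ∧ (sl2 a b c d h) 0 1 = b ∧ (sl2 a b c d h) 1 0 = c ∧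
      (sl2 a b c d h) 1 1 = d := ⟨rfl, rfl, rfl, rfl⟩

theorem sl2_ext {M N : SL(2, F)} (h00 : M 0 0 = N 0 0) (h01 : M 0 1 = N 0 1)
    (h10 : M 1 0 = N 1 0) (h11 : M 1 1 = N 1 1) : M = N := by
  ext i j
  fin_cases i <;> fin_cases j <;> assumption

theorem sl2_mul_apply (M N : SL(2, F)) (i j : Fin 2) :
    (M * N) i j = M i 0 * N 0 j + M i 1 * N 1 j := by
  simp [Matrix.SpecialLinearGroup.coe_mul, Matrix.mul_apply, Fin.sum_univ_two]

theorem sl2_inv_apply (M : SL(2, F)) :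
    M⁻¹ 0 0 = M 1 1 ∧ M⁻¹ 0 1 = -M 0 1 ∧ M⁻¹ 1 0 = -M 1 0 ∧ M⁻¹ 1 1 = M 0 0 := by
  simp [Matrix.SpecialLinearGroup.coe_inv, Matrix.adjugate_fin_two]

/-- The diagonal element with entries `c` and `c⁻¹`. -/
def dg (c : Fˣ) : SL(2, F) := sl2 c 0 0 (c⁻¹ : Fˣ) (by simp)

/-- The upper unitriangular element. -/
def upr (x : F) : SL(2, F) := sl2 1 x 0 1 (by ring)

/-- The lower unitriangular element. -/
def lwr (x : F) : SL(2, F) := sl2 1 0 x 1 (by ring)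

/-- The Weyl element. -/
def wyl : SL(2, F) := sl2 0 1 (-1) 0 (by ring)

@[simp] theorem dg_apply (c : Fˣ) : (dg c) 0 0 = (c : F) ∧ (dg c) 0 1 = 0 ∧ (dg c) 1 0 = 0 ∧
    (dg c) 1 1 = ((c⁻¹ : Fˣ) : F) := ⟨rfl, rfl, rfl, rfl⟩

@[simp] theorem upr_apply (x : F) : (upr x) 0 0 = 1 ∧ (upr x) 0 1 = x ∧ (upr x) 1 0 = 0 ∧
    (upr x) 1 1 = 1 := ⟨rfl, rfl, rfl, rfl⟩

@[simp] theorem lwr_apply (x : F) : (lwr x) 0 0 = 1 ∧ (lwr x) 0 1 = 0 ∧ (lwr x) 1 0 = x ∧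
    (lwr x) 1 1 = 1 := ⟨rfl, rfl, rfl, rfl⟩

@[simp] theorem wyl_apply : (wyl : SL(2, F)) 0 0 = 0 ∧ (wyl : SL(2, F)) 0 1 = 1 ∧
    (wyl : SL(2, F)) 1 0 = -1 ∧ (wyl : SL(2, F)) 1 1 = 0 := ⟨rfl, rfl, rfl, rfl⟩

theorem dg_mul (c d : Fˣ) : dg (c * d) = dg c * dg d := by
  apply sl2_ext <;> simp [sl2_mul_apply, mul_comm]

/-- `dg` as a homomorphism. -/
def dgHom : Fˣ →* SL(2, F) := MonoidHom.mk' dg dg_mul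

theorem upr_add (x y : F) : upr (x + y) = upr x * upr y := by
  apply sl2_ext <;> simp [sl2_mul_apply, add_comm]

theorem lwr_add (x y : F) : lwr (x + y) = lwr x * lwr y := by
  apply sl2_ext <;> simp [sl2_mul_apply]

theorem dg_upr_conj (c : Fˣ) (x : F) : dg c * upr x * (dg c)⁻¹ = upr (c ^ 2 * x) := by
  apply sl2_ext <;> simp [sl2_mul_apply, sl2_inv_apply]
  ring

theorem dg_lwr_conj (c : Fˣ) (x : F) : dg c⁻¹ * lwr x * (dg c⁻¹)⁻¹ = lwr (c ^ 2 * x) := by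
  apply sl2_ext <;> simp [sl2_mul_apply, sl2_inv_apply]
  ring

theorem eq_top_of_upr_lwr {K : Subgroup SL(2, F)} (hu : ∀ x, upr x ∈ K) (hl : ∀ x, lwr x ∈ K) :
    K = ⊤ := by
  refine (eq_top_iff).2 fun M _ => ?_
  refine Matrix.SL2.transvection_induction (· ∈ K) (fun i j hij c => ?_)
    (fun _ _ => K.mul_mem) M
  fin_cases i <;> fin_cases j
  · exact absurd rfl hij
  · convert hu c
    apply sl2_ext <;> simp [Matrix.SpecialLinearGroup.transvection_coe]
  · convert hl c
    apply sl2_ext <;> simp [Matrix.SpecialLinearGroup.transvection_coe]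
  · exact absurd rfl hij

theorem wyl_conj_apply (M : SL(2, F)) :
    (wyl * M * wyl⁻¹ : SL(2, F)) 0 0 = M 1 1 ∧ (wyl * M * wyl⁻¹ : SL(2, F)) 0 1 = -M 1 0 ∧
    (wyl * M * wyl⁻¹ : SL(2, F)) 1 0 = -M 0 1 ∧ (wyl * M * wyl⁻¹ : SL(2, F)) 1 1 = M 0 0 := by
  simp only [sl2_mul_apply, sl2_inv_apply, wyl_apply]
  refine ⟨?_, ?_, ?_, ?_⟩ <;> ring

theorem eq_top_of_map_conj {K : Subgroup SL(2, F)} {g : SL(2, F)}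
    (h : K.map (MulAut.conj g).toMonoidHom = ⊤) :
    K = ⊤ := by
  rw [eq_top_iff]
  intro x _
  have hx : g * x * g⁻¹ ∈ K.map (MulAut.conj g).toMonoidHom := h ▸ Subgroup.mem_top _
  obtain ⟨y, hy, e⟩ := hx
  have e' : g * y * g⁻¹ = g * x * g⁻¹ := e
  have : y = x := by simpa using e'
  exact this ▸ hy

theorem dg_mem_map_conj_wyl {K : Subgroup SL(2, F)} (hD : ∀ c, dg c ∈ K) (c : Fˣ) :
    dg c ∈ K.map (MulAut.conj wyl).toMonoidHom := by
  refine ⟨dg c⁻¹, hD _, ?_⟩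
  show wyl * dg c⁻¹ * wyl⁻¹ = dg c
  obtain ⟨h1, h2, h3, h4⟩ := wyl_conj_apply (dg c⁻¹)
  apply sl2_ext
  · rw [h1]; simp
  · rw [h2]; simp
  · rw [h3]; simp
  · rw [h4]; simp

variable [Fintype F]

theorem exists_sq_add_sq (y : F) : ∃ a b : F, y = a ^ 2 + b ^ 2 := by
  by_cases h2 : ringChar F = 2
  · obtain ⟨a, rfl⟩ := FiniteField.isSquare_of_char_two h2 y
    exact ⟨a, 0, by ring⟩
  · obtain ⟨a, b, h⟩ := FiniteField.exists_root_sum_quadratic (R := F) (f := Polynomial.X ^ 2)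
      (g := Polynomial.X ^ 2 - Polynomial.C y) (by compute_degree!) (by compute_degree!)
      (FiniteField.odd_card_of_char_ne_two h2)
    refine ⟨a, b, ?_⟩
    simp only [Polynomial.eval_pow, Polynomial.eval_X, Polynomial.eval_sub,
      Polynomial.eval_C] at h
    linear_combination -h

theorem forall_mem_of_sq_mul {S : AddSubgroup F} (hS : ∀ (c : Fˣ) x, x ∈ S → (c : F) ^ 2 * x ∈ S)
    {x : F} (hx0 : x ≠ 0) (hx : x ∈ S) (y : F) : y ∈ S := by
  have hS' : ∀ c : F, c ^ 2 * x ∈ S := by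
    intro c
    by_cases hc : c = 0
    · subst hc; simp [S.zero_mem]
    · exact hS (Units.mk0 c hc) x hx
  obtain ⟨a, b, h⟩ := exists_sq_add_sq (y / x)
  have : y = a ^ 2 * x + b ^ 2 * x := by
    rw [← add_mul, ← h, div_mul_cancel₀ _ hx0]
  rw [this]
  exact S.add_mem (hS' a) (hS' b)

variable {K : Subgroup SL(2, F)}

theorem upr_mem_of_ne_zero (hD : ∀ c, dg c ∈ K) {x : F} (hx0 : x ≠ 0) (hx : upr x ∈ K) (y : F) :
    upr y ∈ K := by
  let S : AddSubgroup F :=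
    { carrier := {x | upr x ∈ K}
      add_mem' := fun {a b} ha hb => by
        show upr (a + b) ∈ K
        rw [upr_add]; exact K.mul_mem ha hb
      zero_mem' := by
        show upr 0 ∈ K
        have : (upr 0 : SL(2, F)) = 1 := by apply sl2_ext <;> simp
        rw [this]; exact K.one_mem
      neg_mem' := fun {a} ha => by
        show upr (-a) ∈ K
        have : (upr (-a) : SL(2, F)) = (upr a)⁻¹ := by apply sl2_ext <;> simp [sl2_inv_apply]
        rw [this]; exact K.inv_mem ha }
  exact forall_mem_of_sq_mul (S := S) (fun c x h => by
    show upr _ ∈ K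
    rw [← dg_upr_conj]
    exact K.mul_mem (K.mul_mem (hD c) h) (K.inv_mem (hD c))) hx0 hx y

theorem lwr_mem_of_ne_zero (hD : ∀ c, dg c ∈ K) {x : F} (hx0 : x ≠ 0) (hx : lwr x ∈ K) (y : F) :
    lwr y ∈ K := by
  let S : AddSubgroup F :=
    { carrier := {x | lwr x ∈ K}
      add_mem' := fun {a b} ha hb => by
        show lwr (a + b) ∈ K
        rw [lwr_add]; exact K.mul_mem ha hb
      zero_mem' := by
        show lwr 0 ∈ K
        have : (lwr 0 : SL(2, F)) = 1 := by apply sl2_ext <;> simp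
        rw [this]; exact K.one_mem
      neg_mem' := fun {a} ha => by
        show lwr (-a) ∈ K
        have : (lwr (-a) : SL(2, F)) = (lwr a)⁻¹ := by apply sl2_ext <;> simp [sl2_inv_apply]
        rw [this]; exact K.inv_mem ha }
  exact forall_mem_of_sq_mul (S := S) (fun c x h => by
    show lwr _ ∈ K
    rw [← dg_lwr_conj]
    exact K.mul_mem (K.mul_mem (hD _) h) (K.inv_mem (hD _))) hx0 hx y

theorem eq_top_of_upper (hD : ∀ c, dg c ∈ K) {M N : SL(2, F)} (hM : M ∈ K) (hN : N ∈ K)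
    (hM0 : M 1 0 = 0) (hM1 : M 0 1 ≠ 0) (hN0 : N 1 0 ≠ 0) : K = ⊤ := by
  have hdet := det_entries M
  rw [hM0, mul_zero, sub_zero] at hdet
  have ha : M 0 0 ≠ 0 := left_ne_zero_of_mul_eq_one hdet
  have hu : ∀ x, upr x ∈ K := by
    refine upr_mem_of_ne_zero hD (mul_ne_zero hM1 ha) ?_
    have : upr (M 0 1 * M 0 0) = M * dg (Units.mk0 _ ha)⁻¹ := by
      apply sl2_ext <;> simp [sl2_mul_apply, hM0, ha]
      rw [mul_comm, hdet]
    rw [this]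
    exact K.mul_mem hM (hD _)
  refine eq_top_of_upr_lwr hu (lwr_mem_of_ne_zero hD hN0 ?_)
  have hdetN := det_entries N
  set x := (1 - N 0 0) / N 1 0 with hx
  have hxe : x * N 1 0 = 1 - N 0 0 := div_mul_cancel₀ _ hN0
  have : lwr (N 1 0) = upr x * N * upr (-(N 0 1 + x * N 1 1)) := by
    apply sl2_ext <;> simp [sl2_mul_apply]
    · linear_combination -hxe
    · linear_combination (N 0 1 + x * N 1 1) * hxe
    · linear_combination -hdetN + N 1 1 * hxe
  rw [this]
  exact K.mul_mem (K.mul_mem (hu _) hN) (hu _)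

theorem eq_top_of_lower (hD : ∀ c, dg c ∈ K) {M N : SL(2, F)} (hM : M ∈ K) (hN : N ∈ K)
    (hM0 : M 0 1 = 0) (hM1 : M 1 0 ≠ 0) (hN0 : N 0 1 ≠ 0) : K = ⊤ := by
  obtain ⟨-, h2, h3, -⟩ := wyl_conj_apply M
  obtain ⟨-, -, h3', -⟩ := wyl_conj_apply N
  refine eq_top_of_map_conj (g := wyl) (eq_top_of_upper (dg_mem_map_conj_wyl hD)
    (M := wyl * M * wyl⁻¹) (N := wyl * N * wyl⁻¹) ⟨M, hM, rfl⟩ ⟨N, hN, rfl⟩ ?_ ?_ ?_)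
  · rw [h3, hM0, neg_zero]
  · rw [h2]; exact neg_ne_zero.2 hM1
  · rw [h3']; exact neg_ne_zero.2 hN0

theorem eq_top_of_right_zero (hD : ∀ c, dg c ∈ K) {t : Fˣ} (ht : t ^ 2 ≠ 1) {B : SL(2, F)}
    (hB : B ∈ K) (ha : B 0 0 ≠ 0) (hd : B 1 1 = 0) : K = ⊤ := by
  have hdet := det_entries B
  rw [hd, mul_zero, zero_sub] at hdet
  have hb : B 0 1 ≠ 0 := by intro h; simp [h] at hdet
  have hc : B 1 0 ≠ 0 := by intro h; simp [h] at hdet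
  have ht' : (t : F)⁻¹ - t ≠ 0 := by
    intro h
    apply ht
    ext
    have : (t : F) * (t : F)⁻¹ = 1 := mul_inv_cancel₀ t.ne_zero
    push_cast
    linear_combination -(t : F) * h + this
  refine eq_top_of_upper hD (M := B * dg t * B⁻¹)
    (K.mul_mem (K.mul_mem hB (hD t)) (K.inv_mem hB)) hB ?_ ?_ hc
  · simp [sl2_mul_apply, sl2_inv_apply, hd]
  · have : (B * dg t * B⁻¹ : SL(2, F)) 0 1 = B 0 0 * B 0 1 * ((t : F)⁻¹ - t) := by
      simp [sl2_mul_apply, sl2_inv_apply]; ring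
    rw [this]
    exact mul_ne_zero (mul_ne_zero ha hb) ht'

theorem eq_top_of_one_zero (hD : ∀ c, dg c ∈ K) {t : Fˣ} (ht : t ^ 2 ≠ 1) {B : SL(2, F)}
    (hB : B ∈ K) (h0 : B 0 0 = 0 ∨ B 1 1 = 0) (htr : B 0 0 + B 1 1 ≠ 0) : K = ⊤ := by
  rcases h0 with h | h
  · obtain ⟨h1, -, -, h4⟩ := wyl_conj_apply B
    refine eq_top_of_map_conj (g := wyl) (eq_top_of_right_zero (dg_mem_map_conj_wyl hD) ht
      (B := wyl * B * wyl⁻¹) ⟨B, hB, rfl⟩ ?_ ?_)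
    · rw [h1]; rwa [h, zero_add] at htr
    · rw [h4, h]
  · exact eq_top_of_right_zero hD ht hB (by rwa [h, add_zero] at htr) h

end Generation

section Traces

variable {F : Type*} [Field F]

theorem dg_mem_of_generator {K : Subgroup SL(2, F)} {t : Fˣ} (ht : ∀ c, c ∈ Subgroup.zpowers t)
    (hK : dg t ∈ K) (c : Fˣ) : dg c ∈ K := by
  obtain ⟨n, rfl⟩ := ht c
  have : dg (t ^ n) = dg t ^ n := map_zpow dgHom t n
  show dg (t ^ n) ∈ K
  rw [this]
  exact K.zpow_mem hK n

variable [Fintype F]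

theorem exists_algebraMap_eq_of_pow_card {E : Type*} [Field E] [Algebra F E] {x : E}
    (hx : x ^ Fintype.card F = x) : ∃ b : F, algebraMap F E b = x := by
  classical
  have hne : (Polynomial.X ^ Fintype.card F - Polynomial.X : Polynomial E) ≠ 0 :=
    FiniteField.X_pow_card_sub_X_ne_zero E Fintype.one_lt_card
  have hsub : Finset.univ.map ⟨algebraMap F E, (algebraMap F E).injective⟩ ⊆
      (Polynomial.X ^ Fintype.card F - Polynomial.X : Polynomial E).roots.toFinset := by
    intro y hy
    obtain ⟨b, -, rfl⟩ := Finset.mem_map.1 hy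
    rw [Multiset.mem_toFinset, Polynomial.mem_roots hne]
    simp [← map_pow, FiniteField.pow_card]
  have hcard := (Multiset.toFinset_card_le _).trans
    (Polynomial.card_roots' (Polynomial.X ^ Fintype.card F - Polynomial.X : Polynomial E))
  rw [FiniteField.X_pow_card_sub_X_natDegree_eq E Fintype.one_lt_card] at hcard
  have heq := Finset.eq_of_subset_of_card_le hsub (by simpa using hcard)
  have : x ∈ (Polynomial.X ^ Fintype.card F - Polynomial.X : Polynomial E).roots.toFinset := by
    rw [Multiset.mem_toFinset, Polynomial.mem_roots hne]
    simp [hx]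
  rw [← heq] at this
  obtain ⟨b, -, hb⟩ := Finset.mem_map.1 this
  exact ⟨b, hb⟩

/-- `b` is the sum of a primitive `(q + 1)`-st root of unity and its inverse. -/
def IsNonsplitTrace (b : F) : Prop :=
  ∃ z : AlgebraicClosure F, IsPrimitiveRoot z (Fintype.card F + 1) ∧
    algebraMap F (AlgebraicClosure F) b = z + z⁻¹

variable (F) in
theorem exists_isNonsplitTrace : ∃ b : F, IsNonsplitTrace b := by
  have : NeZero ((Fintype.card F + 1 : ℕ) : F) := ⟨by simp⟩
  have : NeZero ((Fintype.card F + 1 : ℕ) : AlgebraicClosure F) := ⟨by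
    rw [← map_natCast (algebraMap F (AlgebraicClosure F))]; simp⟩
  obtain ⟨z, hz⟩ := HasEnoughRootsOfUnity.exists_primitiveRoot (AlgebraicClosure F)
    (Fintype.card F + 1)
  have hz0 : z ≠ 0 := hz.ne_zero (by omega)
  have hzq : z ^ Fintype.card F = z⁻¹ :=
    eq_inv_of_mul_eq_one_left (by rw [← pow_succ, hz.pow_eq_one])
  obtain ⟨b, hb⟩ := exists_algebraMap_eq_of_pow_card (F := F) (x := z + z⁻¹) (by
    obtain ⟨n, hp, hn, hq⟩ := exists_card_eq_ringChar_pow F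
    have : CharP (AlgebraicClosure F) (ringChar F) :=
      charP_of_injective_algebraMap (algebraMap F _).injective _
    have : ExpChar (AlgebraicClosure F) (ringChar F) := ExpChar.prime hp
    rw [hq, add_pow_expChar_pow, ← hq, inv_pow, hzq, inv_inv, add_comm])
  exact ⟨b, z, hz, hb⟩

theorem IsNonsplitTrace.sub_ne_zero {b : F} (hb : IsNonsplitTrace b) (hF : 4 ≤ Fintype.card F)
    (x : F) : x ^ 2 - b * x + 1 ≠ 0 := by
  obtain ⟨z, hz, hbz⟩ := hb
  intro h
  have hz0 : z ≠ 0 := hz.ne_zero (by omega)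
  have h' := congrArg (algebraMap F (AlgebraicClosure F)) h
  simp only [map_add, map_sub, map_mul, map_pow, map_one, map_zero, hbz] at h'
  set y := algebraMap F (AlgebraicClosure F) x with hy
  have hx0 : x ≠ 0 := by rintro rfl; simp at h
  have hyq : y ^ (Fintype.card F - 1) = 1 := by
    rw [hy, ← map_pow, FiniteField.pow_card_sub_one_eq_one x hx0, map_one]
  have hfac : (y - z) * (y - z⁻¹) = 0 := by
    linear_combination h' + mul_inv_cancel₀ hz0
  have hzq : z ^ (Fintype.card F - 1) = 1 := by
    rcases mul_eq_zero.1 hfac with e | e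
    · rw [← sub_eq_zero.1 e, hyq]
    · rw [← inv_inj, ← inv_pow, ← sub_eq_zero.1 e, hyq, inv_one]
  have := Nat.le_of_dvd (by omega) (hz.dvd_of_pow_eq_one _ hzq)
  omega

theorem IsNonsplitTrace.ne_zero {b : F} (hb : IsNonsplitTrace b) (hF : 4 ≤ Fintype.card F) :
    b ≠ 0 := by
  rintro rfl
  obtain ⟨z, hz, hbz⟩ := hb
  have hz0 : z ≠ 0 := hz.ne_zero (by omega)
  rw [map_zero] at hbz
  have h1 := mul_inv_cancel₀ hz0
  have : z ^ 4 = 1 := by linear_combination (-z - z ^ 3 + 2 * z) * hbz + (- z * z+1) *h1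
  have := Nat.le_of_dvd (by omega) (hz.dvd_of_pow_eq_one _ this)
  omega

theorem IsNonsplitTrace.orderOf_toPSL {b : F} (hb : IsNonsplitTrace b)
    (hF : 4 ≤ Fintype.card F) {M : SL(2, F)} (hM : M 0 0 + M 1 1 = b) :
    orderOf (toPSL M) = pslOrders F 1 := by
  obtain ⟨z, hz, hbz⟩ := hb
  have hz0 : z ≠ 0 := hz.ne_zero (by omega)
  rw [_root_.orderOf_toPSL (algebraMap F (AlgebraicClosure F)) (x := z) hz0 (fun h => by
    have := Nat.le_of_dvd (by omega) (hz.dvd_of_pow_eq_one _ h)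
    omega) (by rw [hM, hbz]), orderOf_pow' z two_ne_zero, ← hz.eq_orderOf]
  rfl

theorem orderOf_toPSL_split (hF : 4 ≤ Fintype.card F) {t : Fˣ}
    (ht : orderOf t = Fintype.card F - 1) {M : SL(2, F)} (hM : M 0 0 + M 1 1 = t + (t : F)⁻¹) :
    orderOf (toPSL M) = pslOrders F 0 := by
  have ht' : orderOf (t : F) = Fintype.card F - 1 := by rw [orderOf_units, ht]
  rw [orderOf_toPSL (RingHom.id F) (x := t) t.ne_zero (fun h => by
    have := Nat.le_of_dvd (by omega) (orderOf_dvd_of_pow_eq_one h)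
    omega) hM, orderOf_pow' _ two_ne_zero, ht']
  rfl

theorem orderOf_toPSL_ringChar {M : SL(2, F)} {e : F} (he : e * e = 1)
    (htr : M 0 0 + M 1 1 = 2 * e) (hM : M 0 1 ≠ 0) : orderOf (toPSL M) = pslOrders F 2 :=
  orderOf_toPSL_unipotent (ringChar F) he htr fun h => hM ((toPSL_eq_one_iff M).1 h).1

variable (F) in
theorem exists_orderOf_eq_card_sub_one :
    ∃ t : Fˣ, orderOf t = Fintype.card F - 1 ∧ ∀ c, c ∈ Subgroup.zpowers t := by
  classical
  obtain ⟨t, ht⟩ := IsCyclic.exists_generator (α := Fˣ)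
  refine ⟨t, ?_, ht⟩
  rw [orderOf_eq_card_of_forall_mem_zpowers ht, Nat.card_eq_fintype_card, Fintype.card_units]

theorem pow_ne_one_of_orderOf {t : Fˣ} (ht : orderOf t = Fintype.card F - 1) {n : ℕ}
    (hn : 0 < n) (h : n < Fintype.card F - 1) : t ^ n ≠ 1 := fun h1 => by
  have := Nat.le_of_dvd hn (orderOf_dvd_of_pow_eq_one h1)
  omega

end Traces

section Orbits

variable {F : Type*} [Field F]

theorem toPSL_mul (M N : SL(2, F)) : toPSL (M * N) = toPSL M * toPSL N := rfl

theorem toPSL_inv (M : SL(2, F)) : toPSL M⁻¹ = (toPSL M)⁻¹ := rfl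

theorem toPSL_pow (M : SL(2, F)) (n : ℕ) : toPSL (M ^ n) = toPSL M ^ n := rfl

/-- The action of `SL(2, F)` on column vectors, written with pairs. -/
def vec (M : SL(2, F)) (v : F × F) : F × F :=
  (M 0 0 * v.1 + M 0 1 * v.2, M 1 0 * v.1 + M 1 1 * v.2)

theorem vec_mul (M N : SL(2, F)) (v : F × F) : vec (M * N) v = vec M (vec N v) := by
  simp only [vec, sl2_mul_apply, Prod.mk.injEq]
  constructor <;> ring

theorem vec_one (v : F × F) : vec 1 v = v := by
  simp [vec]

theorem vec_smul (M : SL(2, F)) (e : F) (v : F × F) : vec M (e • v) = e • vec M v := by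
  simp only [vec, Prod.smul_fst, Prod.smul_snd, smul_eq_mul, Prod.smul_mk, Prod.mk.injEq]
  constructor <;> ring

theorem vec_dg (c : Fˣ) (v : F × F) : vec (dg c) v = (c * v.1, (c : F)⁻¹ * v.2) := by
  simp [vec]

theorem vec_ne_zero (M : SL(2, F)) {v : F × F} (hv : v ≠ 0) : vec M v ≠ 0 := by
  intro h
  apply hv
  rw [← vec_one v, ← inv_mul_cancel M, vec_mul, h]
  simp [vec]

variable {K : Subgroup SL(2, F)}

/-- The `K`-orbit of `v` avoids both coordinate axes. -/
def OffAxes (K : Subgroup SL(2, F)) (v : F × F) : Prop :=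
  ∀ g ∈ K, (vec g v).1 ≠ 0 ∧ (vec g v).2 ≠ 0

theorem OffAxes.not_cover {v : F × F} (hoff : OffAxes K v)
    (hcov : ∀ x : F, x ≠ 0 → ∃ g ∈ K, (vec g v).1 / (vec g v).2 = x) {B : SL(2, F)} (hB : B ∈ K)
    (hb : B 0 1 ≠ 0) (hc : B 1 0 ≠ 0) : B 0 0 + B 1 1 = 0 := by
  by_contra htr
  by_cases ha : B 0 0 = 0
  · have hd : B 1 1 ≠ 0 := by rwa [ha, zero_add] at htr
    obtain ⟨g, hg, h⟩ := hcov (B 0 1 / B 1 1) (div_ne_zero hb hd)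
    rw [div_eq_div_iff (hoff g hg).2 hd] at h
    refine (hoff _ (K.mul_mem (K.inv_mem hB) hg)).1 ?_
    rw [vec_mul]
    simp only [vec, sl2_inv_apply] at h ⊢
    linear_combination h
  · obtain ⟨g, hg, h⟩ := hcov (B 0 0 / B 1 0) (div_ne_zero ha hc)
    rw [div_eq_div_iff (hoff g hg).2 hc] at h
    refine (hoff _ (K.mul_mem (K.inv_mem hB) hg)).2 ?_
    rw [vec_mul]
    simp only [vec, sl2_inv_apply] at h ⊢
    linear_combination -h

theorem exists_ratio_eq_of_isSquare (hD : ∀ c, dg c ∈ K) {v : F × F} (hoff : OffAxes K v)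
    {g : SL(2, F)} (hg : g ∈ K) {x : F} (hx0 : x ≠ 0)
    (hx : IsSquare (x / ((vec g v).1 / (vec g v).2))) :
    ∃ g ∈ K, (vec g v).1 / (vec g v).2 = x := by
  obtain ⟨c, hc⟩ := hx
  have hr := div_ne_zero (hoff g hg).1 (hoff g hg).2
  have hc0 : c ≠ 0 := by
    rintro rfl
    rw [mul_zero] at hc
    exact div_ne_zero hx0 hr hc
  rw [div_eq_iff hr] at hc
  refine ⟨dg (Units.mk0 c hc0) * g, K.mul_mem (hD _) hg, ?_⟩
  rw [vec_mul, vec_dg, hc]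
  have := (hoff g hg).2
  simp only [Units.val_mk0]
  field_simp

theorem commute_entries {M B : SL(2, F)} (h : Commute M B) :
    M 0 1 * B 1 0 = B 0 1 * M 1 0 ∧ M 0 1 * (B 1 1 - B 0 0) = B 0 1 * (M 1 1 - M 0 0) := by
  have h00 := congrArg (fun X : SL(2, F) => X 0 0) h.eq
  have h01 := congrArg (fun X : SL(2, F) => X 0 1) h.eq
  simp only [sl2_mul_apply] at h00 h01
  constructor
  · linear_combination h00
  · linear_combination h01

theorem toPSL_eq_one_of_commute {M B : SL(2, F)} (h : Commute M B)
    (hirr : ∀ x : F, x ^ 2 - (B 0 0 + B 1 1) * x + 1 ≠ 0) {w : F × F} (hw : w.2 ≠ 0)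
    (hpar : (vec M w).1 * w.2 = (vec M w).2 * w.1) : toPSL M = 1 := by
  have hdet := det_entries B
  have hb : B 0 1 ≠ 0 := by
    intro hb
    apply hirr (B 0 0)
    rw [hb] at hdet
    linear_combination -hdet
  obtain ⟨e1, e2⟩ := commute_entries h
  simp only [vec] at hpar
  have key : M 0 1 * (B 1 0 * w.1 ^ 2 + (B 1 1 - B 0 0) * w.1 * w.2 - B 0 1 * w.2 ^ 2) = 0 := by
    linear_combination w.1 ^ 2 * e1 + w.1 * w.2 * e2 - B 0 1 * hpar
  have h01 : M 0 1 = 0 := by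
    refine (mul_eq_zero.1 key).resolve_right fun hz => hirr (B 1 0 * (w.1 / w.2) + B 1 1) ?_
    field_simp
    linear_combination B 1 0 * hz - w.2 ^ 2 * hdet
  rw [h01, zero_mul] at e1 e2
  refine (toPSL_eq_one_iff M).2 ⟨h01, (mul_eq_zero.1 e1.symm).resolve_left hb, ?_⟩
  exact (sub_eq_zero.1 ((mul_eq_zero.1 e2.symm).resolve_left hb)).symm

variable [Fintype F]

theorem eq_top_or_offAxes (hD : ∀ c, dg c ∈ K) {B : SL(2, F)} (hB : B ∈ K)
    (hb : B 0 1 ≠ 0) (hc : B 1 0 ≠ 0) {u : SL(2, F)} (hu : u ∈ K) (hu1 : toPSL u ≠ 1)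
    {v : F × F} (hv : v ≠ 0) {e : F} (he : e * e = 1) (huv : vec u v = e • v) :
    K = ⊤ ∨ OffAxes K v := by
  by_contra! hcon
  obtain ⟨hK, hoff⟩ := hcon
  simp only [OffAxes, not_forall, not_and_or, not_not] at hoff
  obtain ⟨g, hg, h⟩ := hoff
  apply hK
  have hw := vec_ne_zero g hv
  have hM : vec (g * u * g⁻¹) (vec g v) = e • vec g v := by
    rw [← vec_mul, inv_mul_cancel_right, vec_mul, huv, vec_smul]
  have hM1 : toPSL (g * u * g⁻¹) ≠ 1 := by
    intro h
    rw [toPSL_mul, toPSL_mul, toPSL_inv, mul_inv_eq_one] at h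
    exact hu1 (by simpa using h)
  have hMK : g * u * g⁻¹ ∈ K := K.mul_mem (K.mul_mem hg hu) (K.inv_mem hg)
  generalize g * u * g⁻¹ = M at *
  generalize vec g v = w at *
  obtain ⟨x, y⟩ := w
  simp only [vec, Prod.smul_mk, smul_eq_mul, Prod.mk.injEq] at hM
  simp only at h
  rw [Ne, toPSL_eq_one_iff] at hM1
  have hdet := det_entries M
  have e0 : e ≠ 0 := left_ne_zero_of_mul_eq_one he
  rcases h with rfl | rfl
  · have hy : y ≠ 0 := fun h => hw (by simp [h])
    simp only [mul_zero, zero_add] at hM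
    have h01 : M 0 1 = 0 := (mul_eq_zero.1 hM.1).resolve_right hy
    have h11 : M 1 1 = e := mul_right_cancel₀ hy hM.2
    rw [h01, h11, zero_mul, sub_zero] at hdet
    have h00 : M 0 0 = e := mul_right_cancel₀ e0 (by rw [hdet, he])
    exact eq_top_of_lower hD hMK hB h01 (fun h => hM1 ⟨h01, h, by rw [h00, h11]⟩) hb
  · have hx : x ≠ 0 := fun h => hw (by simp [h])
    simp only [mul_zero, add_zero] at hM
    have h10 : M 1 0 = 0 := (mul_eq_zero.1 hM.2).resolve_right hx
    have h00 : M 0 0 = e := mul_right_cancel₀ hx hM.1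
    rw [h10, h00, mul_zero, sub_zero] at hdet
    have h11 : M 1 1 = e := mul_left_cancel₀ e0 (by rw [hdet, he])
    exact eq_top_of_upper hD hMK hB h10 (fun h => hM1 ⟨h, h10, by rw [h00, h11]⟩) hc

theorem isSquare_mul_of_not_isSquare {x y : F} (hx : ¬ IsSquare x) (hy : ¬ IsSquare y) :
    IsSquare (x * y) := by
  have h2 : ringChar F ≠ 2 := fun h => hx (FiniteField.isSquare_of_char_two h x)
  have hx0 : x ≠ 0 := fun h => hx (h ▸ IsSquare.zero)
  have hy0 : y ≠ 0 := fun h => hy (h ▸ IsSquare.zero)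
  rw [FiniteField.isSquare_iff h2 hx0] at hx
  rw [FiniteField.isSquare_iff h2 hy0] at hy
  rw [FiniteField.isSquare_iff h2 (mul_ne_zero hx0 hy0), mul_pow,
    (FiniteField.pow_dichotomy h2 hx0).resolve_left hx,
    (FiniteField.pow_dichotomy h2 hy0).resolve_left hy]
  ring

theorem exists_ratio_eq_of_not_isSquare (hD : ∀ c, dg c ∈ K) {v : F × F} (hoff : OffAxes K v)
    {g h : SL(2, F)} (hg : g ∈ K) (hh : h ∈ K)
    (hgh : ¬ IsSquare (((vec g v).1 / (vec g v).2) / ((vec h v).1 / (vec h v).2)))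
    {x : F} (hx0 : x ≠ 0) : ∃ g ∈ K, (vec g v).1 / (vec g v).2 = x := by
  by_cases hx : IsSquare (x / ((vec g v).1 / (vec g v).2))
  · exact exists_ratio_eq_of_isSquare hD hoff hg hx0 hx
  · refine exists_ratio_eq_of_isSquare hD hoff hh hx0 ?_
    have := isSquare_mul_of_not_isSquare hx hgh
    rwa [div_mul_div_cancel₀ (div_ne_zero (hoff g hg).1 (hoff g hg).2)] at this

variable (F) in
theorem pslOrders_zero_lt_one (hF : 4 ≤ Fintype.card F) :
    0 < pslOrders F 0 ∧ pslOrders F 0 < pslOrders F 1 := by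
  refine ⟨lt_of_lt_of_le two_pos ((orderSystem_pslOrders hF).two_le 0), ?_⟩
  show (Fintype.card F - 1) / Nat.gcd (Fintype.card F - 1) 2 <
    (Fintype.card F + 1) / Nat.gcd (Fintype.card F + 1) 2
  rcases Nat.even_or_odd (Fintype.card F + 1) with h | h
  · have h' : Even (Fintype.card F - 1) := by
      obtain ⟨r, hr⟩ := h
      exact ⟨r - 1, by omega⟩
    rw [Nat.gcd_eq_right h.two_dvd, Nat.gcd_eq_right h'.two_dvd]
    omega
  · have h' : Odd (Fintype.card F - 1) := by
      obtain ⟨r, hr⟩ := h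
      exact ⟨r - 1, by omega⟩
    rw [h.coprime_two_right.gcd_eq_one, h'.coprime_two_right.gcd_eq_one]
    omega

theorem eq_top_of_split_nonsplit (hF : 4 ≤ Fintype.card F) (hD : ∀ c, dg c ∈ K) {t : Fˣ}
    {B : SL(2, F)} (hB : B ∈ K) (hirr : ∀ x : F, x ^ 2 - (B 0 0 + B 1 1) * x + 1 ≠ 0)
    (hord : orderOf (toPSL B) = pslOrders F 1) (h0 : B 0 0 + B 1 1 ≠ 0)
    (htr : t * B 0 0 + (t : F)⁻¹ * B 1 1 = 2) : K = ⊤ := by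
  classical
  have hdet := det_entries B
  have hb : B 0 1 ≠ 0 := by
    intro hb
    apply hirr (B 0 0)
    rw [hb] at hdet
    linear_combination -hdet
  have hc : B 1 0 ≠ 0 := by
    intro hc
    apply hirr (B 0 0)
    rw [hc] at hdet
    linear_combination -hdet
  have ht : (t : F) * (t : F)⁻¹ = 1 := mul_inv_cancel₀ t.ne_zero
  set v : F × F := (t * B 0 1, 1 - t * B 0 0) with hv
  have htb : (t : F) * B 0 1 ≠ 0 := mul_ne_zero t.ne_zero hb
  have hu1 : toPSL (dg t * B) ≠ 1 := fun h => by
    have := ((toPSL_eq_one_iff _).1 h).1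
    simp only [sl2_mul_apply, dg_apply, zero_mul, add_zero] at this
    exact htb this
  have huv : vec (dg t * B) v = (1 : F) • v := by
    rw [one_smul]
    simp only [hv, vec, sl2_mul_apply, dg_apply, Prod.mk.injEq, Units.val_inv_eq_inv_val]
    constructor
    · ring
    · linear_combination -(t : F) * (t : F)⁻¹ * hdet + htr - ht
  rcases eq_top_or_offAxes hD hB hb hc (K.mul_mem (hD t) hB) hu1
    (fun h => htb (congrArg Prod.fst h)) (one_mul 1) huv with h | hoff
  · exact h
  · exfalso
    set N0 := pslOrders F 0
    set N1 := pslOrders F 1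
    obtain ⟨hN0, hN01⟩ := pslOrders_zero_lt_one F hF
    let r : ℕ → F := fun j => (vec (B ^ j) v).1 / (vec (B ^ j) v).2
    have hBj : ∀ j, B ^ j ∈ K := fun j => K.pow_mem hB j
    have hr0 : ∀ j, r j ≠ 0 := fun j => div_ne_zero (hoff _ (hBj j)).1 (hoff _ (hBj j)).2
    by_cases hsq : ∀ j, IsSquare (r j / r 0)
    · have hmaps : ∀ j ∈ Finset.range N1, r j / r 0 ∈ Polynomial.nthRootsFinset N0 (1 : F) := by
        intro j _
        rw [Polynomial.mem_nthRootsFinset hN0]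
        obtain ⟨s, hs⟩ := hsq j
        have hs0 : s ≠ 0 := by
          rintro rfl
          rw [mul_zero] at hs
          exact div_ne_zero (hr0 j) (hr0 0) hs
        rw [hs, ← pow_two]
        exact dvd_div_gcd_two_of_pow (FiniteField.pow_card_sub_one_eq_one s hs0)
      have hlt : ∀ i j, i < j → j < N1 → r i ≠ r j := by
        intro i j hij hj heq
        have hone := toPSL_eq_one_of_commute (M := B ^ (j - i)) (B := B)
          ((Commute.refl B).pow_left _) hirr (w := vec (B ^ i) v) (hoff _ (hBj i)).2 (by
            rw [← vec_mul, ← pow_add, Nat.sub_add_cancel hij.le]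
            have := (div_eq_div_iff (hoff _ (hBj i)).2 (hoff _ (hBj j)).2).1 heq
            linear_combination -this)
        rw [toPSL_pow, ← orderOf_dvd_iff_pow_eq_one, hord] at hone
        have := Nat.le_of_dvd (by omega) hone
        omega
      have hinj : Set.InjOn (fun j => r j / r 0) (Finset.range N1 : Set ℕ) := by
        intro i hi j hj heq
        have heq' : r i = r j := (div_left_inj' (hr0 0)).1 heq
        rw [Finset.mem_coe, Finset.mem_range] at hi hj
        rcases lt_trichotomy i j with h | h | h
        · exact absurd heq' (hlt i j h hj)
        · exact h
        · exact absurd heq'.symm (hlt j i h hi)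
      have hcard := Finset.card_le_card_of_injOn _ hmaps hinj
      have hle : (Polynomial.nthRootsFinset N0 (1 : F)).card ≤ N0 :=
        (Multiset.toFinset_card_le _).trans (Polynomial.card_nthRoots N0 1)
      rw [Finset.card_range] at hcard
      omega
    · push Not at hsq
      obtain ⟨j, hj⟩ := hsq
      exact h0 (hoff.not_cover (fun x hx =>
        exists_ratio_eq_of_not_isSquare hD hoff (hBj j) (hBj 0) hj hx) hB hb hc)

end Orbits

section Unipotent

variable {F : Type*} [Field F]

theorem card_eq_zero_of_add_mem {Y : Finset F} {m : F} (hm : m ≠ 0) (h : ∀ y ∈ Y, y + m ∈ Y) :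
    (Y.card : F) = 0 := by
  classical
  have heq : Y.map (addRightEmbedding m) = Y :=
    Finset.eq_of_subset_of_card_le (fun y hy => by
      obtain ⟨x, hx, rfl⟩ := Finset.mem_map.1 hy
      exact h x hx) (by simp)
  have hsum : ∑ y ∈ Y, y = ∑ y ∈ Y, (y + m) := by
    conv_lhs => rw [← heq]
    rw [Finset.sum_map]
    rfl
  rw [Finset.sum_add_distrib, Finset.sum_const, nsmul_eq_mul] at hsum
  exact (mul_eq_zero.1 (left_eq_add.1 hsum)).resolve_right hm

variable [Fintype F]

open Classical in
theorem two_mul_card_not_isSquare {t : F} (ht : ¬ IsSquare t) :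
    2 * ((Finset.univ.filter fun s : F => ¬ IsSquare s).card : F) = -1 := by
  have ht0 : t ≠ 0 := fun h => ht (h ▸ IsSquare.zero)
  have hbij : (Finset.univ.filter fun s : F => s ≠ 0 ∧ IsSquare s).card =
      (Finset.univ.filter fun s : F => ¬ IsSquare s).card := by
    refine Finset.card_bij' (fun s _ => s * t) (fun s _ => s * t⁻¹) ?_ ?_ ?_ ?_
    · intro s hs
      simp only [Finset.mem_filter, Finset.mem_univ, true_and] at hs ⊢
      intro h
      apply ht
      have := h.mul (IsSquare.inv hs.2)
      rwa [mul_right_comm, mul_inv_cancel₀ hs.1, one_mul] at this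
    · intro s hs
      simp only [Finset.mem_filter, Finset.mem_univ, true_and] at hs ⊢
      refine ⟨mul_ne_zero (fun h => hs (h ▸ IsSquare.zero)) (inv_ne_zero ht0),
        isSquare_mul_of_not_isSquare hs fun h => ht ?_⟩
      simpa using h.inv
    · intro s _
      simp [ht0]
    · intro s _
      simp [ht0]
  have hsplit := Finset.card_filter_add_card_filter_not (s := (Finset.univ : Finset F))
    (fun s => IsSquare s)
  have h0 : (Finset.univ.filter fun s : F => IsSquare s).card =
      (Finset.univ.filter fun s : F => s ≠ 0 ∧ IsSquare s).card + 1 := by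
    rw [← Finset.card_insert_of_notMem (a := (0 : F)) (by simp)]
    congr 1
    ext s
    by_cases hs : s = 0 <;> simp [hs]
  rw [h0, hbij, Finset.card_univ] at hsplit
  have := congrArg (Nat.cast : ℕ → F) hsplit
  push_cast at this
  rw [FiniteField.cast_card_eq_zero] at this
  linear_combination this

theorem eq_top_of_split_unipotent (h2 : (2 : F) ≠ 0) {K : Subgroup SL(2, F)}
    (hD : ∀ c, dg c ∈ K) {t : Fˣ} (ht : ¬ IsSquare (t : F)) {m : F} (hm0 : m ≠ 0)
    (hm : m * (t - 1) = t + 1) {u : SL(2, F)} (hu : u ∈ K) (h00 : u 0 0 = 1 + m)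
    (h01 : u 0 1 = -m) (h10 : u 1 0 = m) (h11 : u 1 1 = 1 - m) : K = ⊤ := by
  classical
  have hb : u 0 1 ≠ 0 := by rw [h01]; exact neg_ne_zero.2 hm0
  have hc : u 1 0 ≠ 0 := by rwa [h10]
  have htt : (t : F) * (t : F)⁻¹ = 1 := mul_inv_cancel₀ t.ne_zero
  rcases eq_top_or_offAxes hD hu hb hc (K.mul_mem (K.inv_mem hu) (hD t)) (v := (1, (t : F)))
    (e := -1) (fun h => by
      have := ((toPSL_eq_one_iff _).1 h).1
      simp only [sl2_mul_apply, sl2_inv_apply, dg_apply, h01, neg_neg, mul_zero, zero_add] at this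
      exact mul_ne_zero hm0 (t⁻¹).ne_zero this)
    (fun h => one_ne_zero (congrArg Prod.fst h)) (by ring) (by
      simp only [vec, sl2_mul_apply, sl2_inv_apply, dg_apply, h00, h01, h10, h11, Prod.smul_mk,
        Prod.mk.injEq, Units.val_inv_eq_inv_val, smul_eq_mul]
      constructor
      · linear_combination -hm + m * htt
      · linear_combination -hm + (1 + m) * htt) with h | hoff
  · exact h
  exfalso
  have hr1 : (vec 1 ((1 : F), (t : F))).1 / (vec 1 ((1 : F), (t : F))).2 = (t : F)⁻¹ := by
    rw [vec_one, one_div]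
  by_cases hsq : ∃ g ∈ K, IsSquare ((vec g ((1 : F), (t : F))).1 / (vec g ((1 : F), (t : F))).2)
  · obtain ⟨g, hg, hgs⟩ := hsq
    have := hoff.not_cover (fun x hx =>
      exists_ratio_eq_of_not_isSquare hD hoff hg K.one_mem (fun h => ht ?_) hx) hu hb hc
    · rw [h00, h11] at this
      exact h2 (by linear_combination this)
    · rw [hr1, div_inv_eq_mul] at h
      have hg0 := div_ne_zero (hoff g hg).1 (hoff g hg).2
      have := h.mul hgs.inv
      rwa [mul_right_comm, mul_inv_cancel₀ hg0, one_mul] at this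
  · push Not at hsq
    set S := Finset.univ.filter fun s : F => ¬ IsSquare s with hS
    have hinj : Function.Injective fun s : F => (s - 1)⁻¹ := fun a b h => by
      simpa using h
    have hzero := card_eq_zero_of_add_mem hm0 (Y := S.map ⟨_, hinj⟩) (fun y hy => by
      obtain ⟨s, hs, rfl⟩ := Finset.mem_map.1 hy
      have hs' : ¬ IsSquare s := by simpa [hS] using hs
      have hs0 : s ≠ 0 := fun h => hs' (h ▸ IsSquare.zero)
      have hs1 : s - 1 ≠ 0 := fun h => hs' (by rw [sub_eq_zero.1 h]; exact IsSquare.one)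
      obtain ⟨g, hg, hgs⟩ := exists_ratio_eq_of_isSquare hD hoff K.one_mem hs0 (by
        rw [hr1, div_inv_eq_mul]
        exact isSquare_mul_of_not_isSquare hs' ht)
      have hug := K.mul_mem hu hg
      refine Finset.mem_map.2 ⟨_, Finset.mem_filter.2 ⟨Finset.mem_univ _, hsq _ hug⟩, ?_⟩
      have hw := hoff _ hug
      have hw2 := (hoff g hg).2
      rw [vec_mul] at hw ⊢
      generalize vec g ((1 : F), (t : F)) = w at *
      obtain ⟨x, y⟩ := w
      simp only [vec, h00, h01, h10, h11] at hgs hw hw2 ⊢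
      show _ = (s - 1)⁻¹ + m
      subst hgs
      have hxy : x - y ≠ 0 := fun h => hs1 (by rw [sub_eq_zero.1 h, div_self hw2, sub_self])
      have e1 : ((1 + m) * x + -m * y) / (m * x + (1 - m) * y) - 1 =
          (x - y) / (m * x + (1 - m) * y) := by
        rw [div_sub_one hw.2]; congr 1; ring
      have e2 : x / y - 1 = (x - y) / y := by rw [div_sub_one hw2]
      show (((1 + m) * x + -m * y) / (m * x + (1 - m) * y) - 1)⁻¹ = _
      rw [e1, e2, inv_div, inv_div]
      field_simp
      ring)
    rw [Finset.card_map] at hzero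
    have := two_mul_card_not_isSquare ht
    rw [← hS, hzero, mul_zero] at this
    exact one_ne_zero (by linear_combination this : (1 : F) = 0)

end Unipotent

section CharTwo

variable {F : Type*} [Field F] [Fintype F]

theorem eq_top_of_char_two [CharP F 2] (hF : 8 ≤ Fintype.card F) {K : Subgroup SL(2, F)}
    (hD : ∀ c, dg c ∈ K) {t : Fˣ} (ht : t ^ 2 ≠ 1) {B : SL(2, F)} (hB : B ∈ K)
    (hb : B 0 1 ≠ 0) (hc : B 1 0 ≠ 0) (had : B 0 0 ≠ 0 ∨ B 1 1 ≠ 0) : K = ⊤ := by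
  have h2 : (2 : F) = 0 := CharTwo.two_eq_zero
  by_cases ha : B 0 0 = 0
  · exact eq_top_of_one_zero hD ht hB (Or.inl ha) (by
      rw [ha, zero_add]; exact had.resolve_left (not_not.2 ha))
  by_cases hd : B 1 1 = 0
  · exact eq_top_of_one_zero hD ht hB (Or.inr hd) (by rwa [hd, add_zero])
  have hdet := det_entries B
  set a := B 0 0
  set b := B 0 1
  set c := B 1 0
  set d := B 1 1
  obtain ⟨s, hs⟩ := Polynomial.exists_eval_ne_zero_of_natDegree_lt_card
    (Polynomial.X * (Polynomial.C a * Polynomial.X ^ 2 + Polynomial.C d) *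
      (Polynomial.C a * Polynomial.X ^ 2 + Polynomial.X + Polynomial.C d))
    (by
      refine mul_ne_zero (mul_ne_zero Polynomial.X_ne_zero fun h => ?_) fun h => ?_
      · exact hd (by simpa using congrArg (Polynomial.eval 0) h)
      · exact hd (by simpa using congrArg (Polynomial.eval 0) h))
    (by
      rw [Cardinal.mk_fintype, Nat.cast_lt]
      refine lt_of_le_of_lt (b := 5) ?_ (by omega)
      compute_degree)
  simp only [Polynomial.eval_mul, Polynomial.eval_add, Polynomial.eval_X, Polynomial.eval_C,
    Polynomial.eval_pow, mul_ne_zero_iff] at hs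
  obtain ⟨⟨hs0, hs1⟩, hs2⟩ := hs
  set f := s * a + s⁻¹ * d with hf
  have hss : s * s⁻¹ = 1 := mul_inv_cancel₀ hs0
  have hf0 : f ≠ 0 := fun h => hs1 (by linear_combination s * h - d * hss)
  have hf1 : f - 1 ≠ 0 := fun h => hs2 (by linear_combination s * h - d * hss + s * h2)
  set h := B * dg (Units.mk0 s hs0) * B with hh
  have hK : h ∈ K := K.mul_mem (K.mul_mem hB (hD _)) hB
  have hdeth := det_entries h
  have h00 : h 0 0 = a * s * a + b * s⁻¹ * c := by simp [hh, sl2_mul_apply, a, b, c]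
  have h01 : h 0 1 = b * f := by simp [hh, sl2_mul_apply, a, b, d, hf]; ring
  have h10 : h 1 0 = c * f := by simp [hh, sl2_mul_apply, a, c, d, hf]; ring
  have h11 : h 1 1 = c * s * b + d * s⁻¹ * d := by simp [hh, sl2_mul_apply, c, b, d]
  have hnot : ¬ (h 0 0 = 0 ∧ h 1 1 = 0) := by
    rintro ⟨e1, e2⟩
    rw [h00] at e1
    rw [h11] at e2
    have e3 : (a * d - b * c) ^ 2 = 0 := by
      linear_combination a * a * s * e2 - b * c * s * e1 +
        (b ^ 2 * c ^ 2 - a ^ 2 * d ^ 2) * hss + (b ^ 2 * c ^ 2 - a * b * c * d) * h2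
    rw [hdet, one_pow] at e3
    exact one_ne_zero e3
  by_cases ha' : h 0 0 = 0
  · exact eq_top_of_one_zero hD ht hK (Or.inl ha') (by
      rw [ha', zero_add]; exact fun h => hnot ⟨ha', h⟩)
  by_cases hd' : h 1 1 = 0
  · exact eq_top_of_one_zero hD ht hK (Or.inr hd') (by rwa [hd', add_zero])
  rw [h01, h10] at hdeth
  have hsq := FiniteField.isSquare_of_char_two (CharP.ringChar_of_prime_eq_zero Nat.prime_two h2)
    (d * f / h 0 0)
  obtain ⟨r, hr⟩ := hsq
  have hr0 : r ≠ 0 := by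
    rintro rfl
    rw [mul_zero] at hr
    exact div_ne_zero (mul_ne_zero hd hf0) ha' hr
  have hrr : r * r⁻¹ = 1 := mul_inv_cancel₀ hr0
  rw [div_eq_iff ha'] at hr
  refine eq_top_of_upper hD (M := B * dg (Units.mk0 r hr0) * h)
    (K.mul_mem (K.mul_mem hB (hD _)) hK) hB ?_ ?_ hc
  · have : (B * dg (Units.mk0 r hr0) * h) 1 0 = c * r * h 0 0 + d * r⁻¹ * (c * f) := by
      simp [sl2_mul_apply, c, d, h10]
    rw [this]
    linear_combination c * r⁻¹ * hr + c * r * h 0 0 * hrr + c * r * h 0 0 * h2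
  · have : (B * dg (Units.mk0 r hr0) * h) 0 1 = a * r * (b * f) + b * r⁻¹ * h 1 1 := by
      simp [sl2_mul_apply, a, b, h01]
    rw [this]
    intro hz
    have : b * (f - 1) ^ 2 = 0 := by
      linear_combination r * h 0 0 * hz + a * b * f * hr - b * h 0 0 * h 1 1 * hrr - b * hdeth -
        b * f ^ 2 * hdet - (b * (b * c) * f ^ 2 + b * f) * h2
    exact mul_ne_zero hb (pow_ne_zero 2 hf1) this

end CharTwo

section Columns

theorem OrderSystem.exists_not_commute {H : Type*} [Group H] {N : Fin 3 → ℕ}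
    (hN : OrderSystem H N) (Z : HasColumn H N ![0, 1, 2]) : ∃ x y : H, x * y ≠ y * x := by
  obtain ⟨a, b, c, habc, -, ha, hb, hc⟩ := Z
  refine ⟨a, b, fun hab => ?_⟩
  have ha' : orderOf a = N 0 := (hasCode_iff_orderOf (by decide)).1 ha
  have hb' : orderOf b = N 1 := (hasCode_iff_orderOf (by decide)).1 hb
  have hc' : orderOf c = N 2 := (hasCode_iff_orderOf (by decide)).1 hc
  have h : orderOf (a * b) = N 0 * N 1 := by
    rw [← ha', ← hb']
    exact (show Commute a b from hab).orderOf_mul_eq_mul_orderOf_of_coprime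
      (by rw [ha', hb']; exact hN.coprime 0 1 (by decide))
  rw [eq_inv_of_mul_eq_one_left habc, orderOf_inv, hc'] at h
  have h1 := Nat.eq_one_of_dvd_coprimes (hN.coprime 0 2 (by decide)) dvd_rfl
    (h ▸ dvd_mul_right _ _)
  have := hN.two_le 0
  omega

/-- In a simple group, conjugating `b` by the involution `a` gives a second generating pair. -/
theorem HasColumn.conj_involution {H : Type*} [Group H] [IsSimpleGroup H] {N : Fin 3 → ℕ}
    (h0 : N 0 = 2) (h1 : N 1 ≠ 1) (h2 : Odd (N 2)) (Z : HasColumn H N ![0, 1, 2]) :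
    HasColumn H N ![1, 1, 2] := by
  obtain ⟨a, b, c, habc, hgen, ha, hb, hc⟩ := Z
  have ha' : orderOf a = 2 := h0 ▸ (hasCode_iff_orderOf (by decide)).1 ha
  have hb' : orderOf b = N 1 := (hasCode_iff_orderOf (by decide)).1 hb
  have hc' : orderOf c = N 2 := (hasCode_iff_orderOf (by decide)).1 hc
  have haa : a * a = 1 := by rw [← sq, ← ha', pow_orderOf_eq_one]
  have hainv : a⁻¹ = a := inv_eq_of_mul_eq_one_left haa
  set L := Subgroup.closure {b, a * b * a⁻¹} with hL
  have hbL : b ∈ L := Subgroup.subset_closure (by simp)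
  have haL : a ∈ Subgroup.normalizer (L : Set H) := by
    have hmap : L.map (MulAut.conj a).toMonoidHom ≤ L := by
      rw [hL, MonoidHom.map_closure, Subgroup.closure_le]
      rintro - ⟨x, rfl | rfl, rfl⟩
      · exact Subgroup.subset_closure (Or.inr rfl)
      · refine Subgroup.subset_closure (Or.inl ?_)
        show a * (a * b * a⁻¹) * a⁻¹ = b
        rw [hainv]
        calc a * (a * b * a) * a = (a * a) * b * (a * a) := by group
          _ = b := by rw [haa, one_mul, mul_one]
    have hc : ∀ x ∈ L, a * x * a⁻¹ ∈ L := fun x hx => hmap ⟨x, hx, rfl⟩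
    rw [Subgroup.mem_normalizer_iff]
    refine fun x => ⟨hc x, fun h => ?_⟩
    have := hc _ h
    rw [hainv] at this
    have e : a * (a * x * a) * a = (a * a) * x * (a * a) := by group
    rwa [e, haa, one_mul, mul_one] at this
  have hnorm : L.Normal := by
    rw [← Subgroup.normalizer_eq_top_iff, eq_top_iff, ← hgen, Subgroup.closure_le]
    rintro x (rfl | rfl)
    · exact haL
    · exact Subgroup.le_normalizer hbL
  have htop : L = ⊤ := hnorm.eq_bot_or_eq_top.resolve_left fun h => h1 (by
    rw [← hb', orderOf_eq_one_iff]
    exact (Subgroup.mem_bot.1 (h ▸ hbL)))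
  refine ⟨b, a * b * a⁻¹, (b * (a * b * a⁻¹))⁻¹, mul_inv_cancel _, htop, hb, ?_, ?_⟩
  · refine (hasCode_iff_orderOf (by decide)).2 ?_
    have := orderOf_injective (MulAut.conj a).toMonoidHom (MulAut.conj a).injective b
    exact this.trans hb'
  · refine (hasCode_iff_orderOf (by decide)).2 ?_
    show _ = N 2
    have e : b * (a * b * a⁻¹) = (b * a) ^ 2 := by
      rw [hainv, sq]; simp only [mul_assoc]
    have hab : orderOf (b * a) = N 2 := by
      have e' : b * a = a⁻¹ * (a * b) * a⁻¹⁻¹ := by group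
      have := orderOf_injective (MulAut.conj a⁻¹).toMonoidHom (MulAut.conj a⁻¹).injective (a * b)
      rw [e']
      refine this.trans ?_
      rw [eq_inv_of_mul_eq_one_left habc, orderOf_inv, hc']
    rw [orderOf_inv, e, orderOf_pow' _ two_ne_zero, hab, h2.coprime_two_right.gcd_eq_one,
      Nat.div_one]

variable {F : Type*} [Field F]

theorem hasColumn_of_closure {N : Fin 3 → ℕ} {A B : SL(2, F)} {e0 e1 e2 : Fin 4}
    (hgen : Subgroup.closure {A, B} = ⊤) (h0 : HasCode N e0 (toPSL A))
    (h1 : HasCode N e1 (toPSL B)) (h2 : HasCode N e2 (toPSL (A * B))) :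
    HasColumn PSL(2, F) N ![e0, e1, e2] := by
  refine ⟨toPSL A, toPSL B, (toPSL (A * B))⁻¹, mul_inv_cancel _, ?_, h0, h1, ?_⟩
  · have := congrArg (Subgroup.map (QuotientGroup.mk' (Subgroup.center SL(2, F)))) hgen
    rw [MonoidHom.map_closure, Set.image_pair,
      Subgroup.map_top_of_surjective _ (QuotientGroup.mk'_surjective _)] at this
    exact this
  · show HasCode N e2 _
    unfold HasCode at h2 ⊢
    rwa [orderOf_inv]

theorem exists_sl2_traces {t : F} (ht0 : t ≠ 0) (ht : t ^ 2 ≠ 1) (x y : F) :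
    ∃ B : SL(2, F), B 0 0 + B 1 1 = x ∧ t * B 0 0 + t⁻¹ * B 1 1 = y ∧ B 0 1 = 1 ∧
      B 1 0 = B 0 0 * B 1 1 - 1 := by
  have h : t - t⁻¹ ≠ 0 := fun h => ht (by linear_combination t * h + mul_inv_cancel₀ ht0)
  set a := (y - t⁻¹ * x) / (t - t⁻¹) with ha
  have ha' : a * (t - t⁻¹) = y - t⁻¹ * x := div_mul_cancel₀ _ h
  refine ⟨sl2 a 1 (a * (x - a) - 1) (x - a) (by ring), ?_, ?_, ?_, ?_⟩
  all_goals simp only [sl2_apply]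
  · ring
  · linear_combination ha'

theorem dg_mul_trace (t : Fˣ) (B : SL(2, F)) :
    (dg t * B) 0 0 + (dg t * B) 1 1 = t * B 0 0 + (t : F)⁻¹ * B 1 1 ∧
      (dg t * B) 0 1 = t * B 0 1 := by
  simp [sl2_mul_apply]

/-- The element with rows `(b, 1)` and `(-1, 0)`. -/
def companion (b : F) : SL(2, F) := sl2 b 1 (-1) 0 (by ring)

theorem companion_apply (b : F) : companion b 0 0 = b ∧ companion b 0 1 = 1 ∧
    companion b 1 0 = -1 ∧ companion b 1 1 = 0 := ⟨rfl, rfl, rfl, rfl⟩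

variable [Fintype F]

theorem hasColumn_of_dg (hF : 4 ≤ Fintype.card F) {t : Fˣ} (ht : orderOf t = Fintype.card F - 1)
    {B : SL(2, F)} {e1 e2 : Fin 4}
    (hgen : ∀ K : Subgroup SL(2, F), (∀ c, dg c ∈ K) → B ∈ K → K = ⊤)
    (h1 : HasCode (pslOrders F) e1 (toPSL B)) (h2 : HasCode (pslOrders F) e2 (toPSL (dg t * B))) :
    HasColumn PSL(2, F) (pslOrders F) ![0, e1, e2] := by
  classical
  refine hasColumn_of_closure (hgen _ (dg_mem_of_generator (t := t) ?_
    (Subgroup.subset_closure (by simp))) (Subgroup.subset_closure (by simp))) ?_ h1 h2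
  · have : Subgroup.zpowers t = ⊤ := Subgroup.eq_top_of_card_eq _ (by
      rw [Nat.card_zpowers, ht, Nat.card_eq_fintype_card, Fintype.card_units])
    simp [this]
  · refine (hasCode_iff_orderOf (by decide)).2 (orderOf_toPSL_split hF ht ?_)
    simp

theorem IsNonsplitTrace.hasCode {b : F} (hb : IsNonsplitTrace b) (hF : 4 ≤ Fintype.card F)
    {M : SL(2, F)} (hM : M 0 0 + M 1 1 = b) : HasCode (pslOrders F) 1 (toPSL M) :=
  (hasCode_iff_orderOf (by decide)).2 (hb.orderOf_toPSL hF hM)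

theorem hasCode_ringChar {M : SL(2, F)} {e : F} (he : e * e = 1)
    (htr : M 0 0 + M 1 1 = 2 * e) (hM : M 0 1 ≠ 0) : HasCode (pslOrders F) 2 (toPSL M) :=
  (hasCode_iff_orderOf (by decide)).2 (orderOf_toPSL_ringChar he htr hM)

theorem hasCode_split (hF : 4 ≤ Fintype.card F) {t : Fˣ} (ht : orderOf t = Fintype.card F - 1)
    {M : SL(2, F)} (hM : M 0 0 + M 1 1 = t + (t : F)⁻¹) : HasCode (pslOrders F) 0 (toPSL M) :=
  (hasCode_iff_orderOf (by decide)).2 (orderOf_toPSL_split hF ht hM)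

theorem units_sq_ne_one (hF : 4 ≤ Fintype.card F) {t : Fˣ}
    (ht : orderOf t = Fintype.card F - 1) : t ^ 2 ≠ 1 ∧ (t : F) ^ 2 ≠ 1 := by
  have h := pow_ne_one_of_orderOf ht (n := 2) (by omega) (by omega)
  exact ⟨h, fun h' => h (Units.ext (by simpa using h'))⟩

variable (F) in
theorem hasColumn_split_nonsplit_unipotent (hF : 4 ≤ Fintype.card F) :
    HasColumn PSL(2, F) (pslOrders F) ![0, 1, 2] := by
  obtain ⟨t, ht, -⟩ := exists_orderOf_eq_card_sub_one F
  obtain ⟨b, hb⟩ := exists_isNonsplitTrace F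
  obtain ⟨B, h1, h2, h3, -⟩ := exists_sl2_traces t.ne_zero (units_sq_ne_one hF ht).2 b 2
  refine hasColumn_of_dg hF ht (B := B) (fun K hD hB => ?_) (hb.hasCode hF h1)
    (hasCode_ringChar (one_mul 1) ?_ ?_)
  · exact eq_top_of_split_nonsplit hF hD hB (by rw [h1]; exact hb.sub_ne_zero hF)
      (hb.orderOf_toPSL hF h1) (by rw [h1]; exact hb.ne_zero hF) h2
  · rw [(dg_mul_trace t B).1, h2, mul_one]
  · rw [(dg_mul_trace t B).2, h3, mul_one]
    exact t.ne_zero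

variable (F) in
theorem hasColumn_split_unipotent_unipotent (hF : 4 ≤ Fintype.card F) (hp : ringChar F ≠ 2) :
    HasColumn PSL(2, F) (pslOrders F) ![0, 2, 2] := by
  obtain ⟨t, ht, -⟩ := exists_orderOf_eq_card_sub_one F
  have hodd := FiniteField.odd_card_of_char_ne_two hp
  have htF := (units_sq_ne_one hF ht).2
  have htsq : ¬ IsSquare (t : F) := by
    rw [FiniteField.isSquare_iff hp t.ne_zero]
    intro h
    exact pow_ne_one_of_orderOf ht (n := Fintype.card F / 2) (by omega) (by omega)
      (Units.ext (by simpa using h))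
  have ht1 : (t : F) - 1 ≠ 0 := fun h => htF (by linear_combination ((t : F) + 1) * h)
  have ht2 : (t : F) + 1 ≠ 0 := fun h => htF (by linear_combination ((t : F) - 1) * h)
  have htt : (t : F) * (t : F)⁻¹ = 1 := mul_inv_cancel₀ t.ne_zero
  set m := ((t : F) + 1) / (t - 1) with hm
  have hm0 : m ≠ 0 := div_ne_zero ht2 ht1
  have hm' : m * (t - 1) = t + 1 := div_mul_cancel₀ _ ht1
  let B : SL(2, F) := sl2 (1 - m) m (-m) (1 + m) (by ring)
  have hB : B 0 0 = 1 - m ∧ B 0 1 = m ∧ B 1 0 = -m ∧ B 1 1 = 1 + m := sl2_apply _ _ _ _ _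
  refine hasColumn_of_dg hF ht (B := B) (fun K hD hBK => ?_)
    (hasCode_ringChar (one_mul 1) ?_ ?_) (hasCode_ringChar (e := -1) (by ring) ?_ ?_)
  · refine eq_top_of_split_unipotent (Ring.two_ne_zero hp) hD htsq hm0 hm' (K.inv_mem hBK)
      ?_ ?_ ?_ ?_ <;> simp [sl2_inv_apply, hB]
  · rw [hB.1, hB.2.2.2]; ring
  · rwa [hB.2.1]
  · rw [(dg_mul_trace t B).1, hB.1, hB.2.2.2]
    linear_combination -(1 + (t : F)⁻¹) * hm' + (m - 1) * htt
  · rw [(dg_mul_trace t B).2, hB.2.1]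
    exact mul_ne_zero t.ne_zero hm0

theorem eq_top_of_companion (hF : 4 ≤ Fintype.card F) {b : F} (hb : b ≠ 0)
    {K : Subgroup SL(2, F)} (hD : ∀ c, dg c ∈ K) (hB : companion b ∈ K) : K = ⊤ := by
  obtain ⟨t, ht, -⟩ := exists_orderOf_eq_card_sub_one F
  refine eq_top_of_one_zero hD (units_sq_ne_one hF ht).1 hB (Or.inr (companion_apply b).2.2.2) ?_
  rwa [(companion_apply b).1, (companion_apply b).2.2.2, add_zero]

variable (F) in
theorem hasColumn_coprime_split_nonsplit (hF : 7 ≤ Fintype.card F) :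
    HasColumn PSL(2, F) (pslOrders F) ![3, 0, 1] := by
  have hF' : 4 ≤ Fintype.card F := by omega
  obtain ⟨t, ht, -⟩ := exists_orderOf_eq_card_sub_one F
  obtain ⟨b, hb⟩ := exists_isNonsplitTrace F
  have hex : ∃ s : Fˣ, orderOf s = Fintype.card F - 1 ∧ (s * b) ^ 2 ≠ 4 := by
    by_contra! hcon
    have h1 := hcon t ht
    have h2 := hcon t⁻¹ (by rw [orderOf_inv, ht])
    have htt : (t : F) * ((t⁻¹ : Fˣ) : F) = 1 := t.mul_inv
    refine pow_ne_one_of_orderOf ht (n := 4) (by omega) (by omega) (Units.ext ?_)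
    push_cast
    have hb2 : b ^ 2 ≠ 0 := pow_ne_zero 2 (hb.ne_zero hF')
    have h4 : ((t : F) ^ 4 - 1) * b ^ 2 = 0 := by
      have e : ((t⁻¹ : Fˣ) : F) * b * t = b := by linear_combination b * htt
      have : b ^ 2 = 4 * (t : F) ^ 2 := by
        rw [← h2, ← mul_pow, e]
      linear_combination (t : F) ^ 2 * h1 - this
    exact sub_eq_zero.1 ((mul_eq_zero.1 h4).resolve_right hb2)
  obtain ⟨s, hs, hsb⟩ := hex
  have h : HasColumn PSL(2, F) (pslOrders F) ![0, 1, 3] := by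
    refine hasColumn_of_dg hF' hs (B := companion b)
      (fun K hD hB => eq_top_of_companion hF' (hb.ne_zero hF') hD hB)
      (hb.hasCode hF' (by simp [companion_apply])) ?_
    show HasCode _ 3 _
    unfold HasCode
    rw [dif_neg (by decide)]
    refine orderOf_toPSL_coprime hF' ?_
    rw [(dg_mul_trace s _).1, (companion_apply b).1, (companion_apply b).2.2.2, mul_zero, add_zero]
    exact hsb
  exact h.rotate.rotate

section Even

variable [CharP F 2]

theorem hasColumn_of_traces (hF : 8 ≤ Fintype.card F) {t : Fˣ}
    (ht : orderOf t = Fintype.card F - 1) {B : SL(2, F)} {e1 e2 : Fin 4} (h01 : B 0 1 = 1)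
    (h10 : B 1 0 ≠ 0) (htr : B 0 0 ≠ 0 ∨ B 1 1 ≠ 0) (h1 : HasCode (pslOrders F) e1 (toPSL B))
    (h2 : HasCode (pslOrders F) e2 (toPSL (dg t * B))) :
    HasColumn PSL(2, F) (pslOrders F) ![0, e1, e2] :=
  hasColumn_of_dg (by omega) ht (fun _ hD hB => eq_top_of_char_two hF hD
    (units_sq_ne_one (by omega) ht).1 hB (by rw [h01]; exact one_ne_zero) h10 htr) h1 h2

variable (F) in
theorem hasColumn_split_nonsplit_nonsplit (hF : 8 ≤ Fintype.card F) :
    HasColumn PSL(2, F) (pslOrders F) ![0, 1, 1] := by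
  have hF' : 4 ≤ Fintype.card F := by omega
  obtain ⟨t, ht, -⟩ := exists_orderOf_eq_card_sub_one F
  obtain ⟨b, hb⟩ := exists_isNonsplitTrace F
  obtain ⟨B, h1, h2, h3, h4⟩ := exists_sl2_traces t.ne_zero (units_sq_ne_one hF' ht).2 b b
  refine hasColumn_of_traces hF ht h3 (fun h => ?_) ?_ (hb.hasCode hF' h1)
    (hb.hasCode hF' ((dg_mul_trace t B).1.trans h2))
  · rw [h4] at h
    exact hb.sub_ne_zero hF' (B 0 0) (by rw [← h1]; linear_combination -h)
  · by_contra! h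
    exact hb.ne_zero hF' (by rw [← h1, h.1, h.2, add_zero])

variable (F) in
theorem hasColumn_split_split_nonsplit (hF : 8 ≤ Fintype.card F) :
    HasColumn PSL(2, F) (pslOrders F) ![0, 0, 1] := by
  have hF' : 4 ≤ Fintype.card F := by omega
  obtain ⟨t, ht, -⟩ := exists_orderOf_eq_card_sub_one F
  obtain ⟨b, hb⟩ := exists_isNonsplitTrace F
  obtain ⟨B, h1, h2, h3, h4⟩ := exists_sl2_traces t.ne_zero (units_sq_ne_one hF' ht).2
    (t + (t : F)⁻¹) b
  refine hasColumn_of_traces hF ht h3 (fun h => ?_) ?_ (hasCode_split hF' ht h1)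
    (hb.hasCode hF' ((dg_mul_trace t B).1.trans h2))
  · rw [h4] at h
    refine hb.sub_ne_zero hF' (t * B 0 0) ?_
    rw [← h2]
    linear_combination -h - B 0 0 * B 1 1 * mul_inv_cancel₀ t.ne_zero
  · by_contra! h
    exact hb.ne_zero hF' (by rw [← h2, h.1, h.2, mul_zero, mul_zero, add_zero])

variable (F) in
theorem hasColumn_split_split_unipotent (hF : 8 ≤ Fintype.card F) :
    HasColumn PSL(2, F) (pslOrders F) ![0, 0, 2] := by
  have hF' : 4 ≤ Fintype.card F := by omega
  have htwo : (2 : F) = 0 := CharTwo.two_eq_zero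
  obtain ⟨t, ht, -⟩ := exists_orderOf_eq_card_sub_one F
  obtain ⟨n, -, hn, hq⟩ := exists_card_eq_ringChar_pow F
  have ht2 : orderOf (t ^ 2) = Fintype.card F - 1 := by
    have hodd : Odd (Fintype.card F - 1) := by
      rw [CharP.ringChar_of_prime_eq_zero Nat.prime_two htwo] at hq
      obtain ⟨r, hr⟩ := (Nat.even_pow.2 ⟨even_two, hn.ne'⟩ : Even (2 ^ n))
      exact ⟨r - 1, by omega⟩
    rw [orderOf_pow' _ two_ne_zero, ht, hodd.coprime_two_right.gcd_eq_one, Nat.div_one]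
  have htt : (t : F) * (t : F)⁻¹ = 1 := mul_inv_cancel₀ t.ne_zero
  set w := (t : F)⁻¹
  let B : SL(2, F) := sl2 (1 + w ^ 2) 1 ((1 + w ^ 2) * (t ^ 2 + 1) - 1) (t ^ 2 + 1) (by ring)
  have hB : B 0 0 = 1 + w ^ 2 ∧ B 0 1 = 1 ∧ B 1 0 = (1 + w ^ 2) * (t ^ 2 + 1) - 1 ∧
    B 1 1 = t ^ 2 + 1 := sl2_apply _ _ _ _ _
  have hd : (t : F) ^ 2 + 1 ≠ 0 := fun h =>
    (units_sq_ne_one hF' ht).2 (by linear_combination h - htwo)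
  refine hasColumn_of_traces hF ht hB.2.1 (fun h => ?_) (Or.inr (by rwa [hB.2.2.2]))
    (hasCode_split hF' ht2 ?_) (hasCode_ringChar (one_mul 1) ?_ ?_)
  · rw [hB.2.2.1] at h
    have hsq : ((t : F) ^ 2 + t + 1) ^ 2 = 0 := by
      linear_combination (t : F) ^ 2 * h +
        (-(t * w) - 1 - t ^ 3 * w - t ^ 2) * htt + (t ^ 3 + t ^ 2 + t : F) * htwo
    have h3 : (t : F) ^ 2 + t + 1 = 0 := pow_eq_zero_iff two_ne_zero |>.1 hsq
    refine pow_ne_one_of_orderOf ht (n := 3) (by omega) (by omega) (Units.ext ?_)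
    push_cast
    linear_combination ((t : F) - 1) * h3
  · rw [hB.1, hB.2.2.2]
    push_cast
    rw [← inv_pow]
    linear_combination htwo
  · rw [(dg_mul_trace t B).1, hB.1, hB.2.2.2]
    linear_combination ((t : F) + w) * htt + ((t : F) + w - 1) * htwo
  · rw [(dg_mul_trace t B).2, hB.2.1, mul_one]
    exact t.ne_zero

end Even

end Columns

section Four

variable {F : Type*} [Field F] [Fintype F]

theorem IsNonsplitTrace.sq [CharP F 2] {b : F} (hb : IsNonsplitTrace b) :
    IsNonsplitTrace (b ^ 2) := by
  obtain ⟨z, hz, hbz⟩ := hb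
  have : CharP (AlgebraicClosure F) 2 :=
    charP_of_injective_algebraMap (algebraMap F _).injective _
  have heven : Even (Fintype.card F) := by
    obtain ⟨n, -, hn, hq⟩ := exists_card_eq_ringChar_pow F
    rw [ringChar.eq F 2] at hq
    rw [hq]
    exact Nat.even_pow.2 ⟨even_two, hn.ne'⟩
  refine ⟨z ^ 2, hz.pow_of_coprime 2 ?_, ?_⟩
  · exact heven.add_one.coprime_two_left
  · rw [map_pow, hbz, CharTwo.add_sq, inv_pow]

variable [CharP F 2]

/-- In the field with four elements, nonsplit traces generate the multiplicative group. -/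
theorem exists_generator_isNonsplitTrace (hF : Fintype.card F = 4) :
    ∃ t : Fˣ, IsNonsplitTrace (t : F) ∧ orderOf t = Fintype.card F - 1 ∧
      (t : F) ^ 2 + t + 1 = 0 := by
  obtain ⟨b, hb⟩ := exists_isNonsplitTrace F
  have hbb : b ^ 2 + b + 1 = 0 := by
    have hb0 := hb.ne_zero hF.ge
    obtain ⟨t, ht, -⟩ := exists_orderOf_eq_card_sub_one F
    have h3 : ∀ x : Fˣ, (x : F) ^ 3 = 1 := fun x => by
      have := FiniteField.pow_card_sub_one_eq_one (x : F) x.ne_zero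
      rwa [hF] at this
    have key : ∀ x : Fˣ, (x : F) ≠ 1 → (x : F) ^ 2 + x + 1 = 0 := fun x hx => by
      have : ((x : F) - 1) * (x ^ 2 + x + 1) = 0 := by linear_combination h3 x
      exact (mul_eq_zero.1 this).resolve_left (sub_ne_zero.2 hx)
    refine key (Units.mk0 b hb0) fun h1 => ?_
    rw [Units.val_mk0] at h1
    have ht1 : (t : F) ≠ 1 := fun h => (units_sq_ne_one hF.ge ht).2 (by rw [h, one_pow])
    refine hb.sub_ne_zero hF.ge (t : F) ?_
    rw [h1, CharTwo.sub_eq_add, one_mul]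
    exact key t ht1
  refine ⟨Units.mk0 b (hb.ne_zero hF.ge), hb, ?_, hbb⟩
  refine Eq.trans (b := 3) ?_ (by rw [hF])
  refine orderOf_eq_prime (Units.ext ?_) fun h => ?_
  · push_cast
    rw [Units.val_mk0]
    linear_combination (b - 1) * hbb
  · have h1 : b = 1 := by simpa using congrArg Units.val h
    rw [h1] at hbb
    have htwo : (2 : F) = 0 := CharTwo.two_eq_zero
    exact one_ne_zero (α := F) (by linear_combination hbb - htwo)

theorem hasColumn_split_split_nonsplit_of_card_eq_four (hF : Fintype.card F = 4) :
    HasColumn PSL(2, F) (pslOrders F) ![0, 0, 1] := by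
  obtain ⟨t, hb, ht, htt⟩ := exists_generator_isNonsplitTrace hF
  have hw : (t : F) * (t : F)⁻¹ = 1 := mul_inv_cancel₀ t.ne_zero
  have htwo : (2 : F) = 0 := CharTwo.two_eq_zero
  refine hasColumn_of_dg hF.ge ht (B := companion 1)
    (fun K hD hB => eq_top_of_companion hF.ge one_ne_zero hD hB)
    (hasCode_split hF.ge ht ?_) (hb.hasCode hF.ge ?_)
  · rw [(companion_apply (1 : F)).1, (companion_apply (1 : F)).2.2.2]
    linear_combination -(t : F)⁻¹ * htt + ((t : F) + 1) * hw + htwo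
  · rw [(dg_mul_trace t _).1, (companion_apply (1 : F)).1, (companion_apply (1 : F)).2.2.2]
    ring

theorem hasColumn_nonsplit_nonsplit_unipotent_of_card_eq_four (hF : Fintype.card F = 4) :
    HasColumn PSL(2, F) (pslOrders F) ![1, 1, 2] := by
  obtain ⟨t, hb, ht, htt⟩ := exists_generator_isNonsplitTrace hF
  have hw : (t : F) * (t : F)⁻¹ = 1 := mul_inv_cancel₀ t.ne_zero
  have htwo : (2 : F) = 0 := CharTwo.two_eq_zero
  obtain ⟨c1, c2, c3, c4⟩ := companion_apply (t : F)
  set B := companion (t : F) with hB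
  have hgen : Subgroup.closure {dg t * B, B} = ⊤ := by
    have hBm : B ∈ Subgroup.closure {dg t * B, B} := Subgroup.subset_closure (by simp)
    have hd : dg t ∈ Subgroup.closure {dg t * B, B} := by
      have := mul_mem (Subgroup.subset_closure (by simp) : dg t * B ∈ Subgroup.closure {dg t * B, B})
        (inv_mem hBm)
      rwa [mul_inv_cancel_right] at this
    refine eq_top_of_companion hF.ge t.ne_zero (dg_mem_of_generator (t := t) ?_ hd) hBm
    have : Subgroup.zpowers t = ⊤ := Subgroup.eq_top_of_card_eq _ (by
      classical
      rw [Nat.card_zpowers, ht, Nat.card_eq_fintype_card, Fintype.card_units])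
    simp [this]
  refine hasColumn_of_closure hgen (hb.sq.hasCode hF.ge ?_) (hb.hasCode hF.ge ?_)
    (hasCode_ringChar (one_mul 1) ?_ ?_)
  · rw [(dg_mul_trace t _).1, c1, c4]
    ring
  · rw [c1, c4, add_zero]
  · rw [mul_assoc, (dg_mul_trace t _).1]
    simp only [sl2_mul_apply, c1, c2, c3, c4]
    linear_combination ((t : F) - 1) * htt - (t : F)⁻¹ * htt + ((t : F) + 1) * hw
  · rw [mul_assoc, (dg_mul_trace t _).2]
    simp only [sl2_mul_apply, c1, c2, c4]
    rw [mul_zero, add_zero, mul_one]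
    exact mul_ne_zero t.ne_zero t.ne_zero

end Four

theorem beauville_psl2_powers (F : Type*) [Field F] [Fintype F] (hq : 4 ≤ Fintype.card F)
    (k : ℕ) (hk2 : 2 ≤ k) (hk : k * Nat.card (MulAut PSL(2, F)) ≤ phi2 PSL(2, F)) :
    HasBeauvilleStructure (Fin k → PSL(2, F)) := by
  have : IsSimpleGroup PSL(2, F) :=
    Matrix.ProjectiveSpecialLinearGroup.rank_two_simple (by rwa [Nat.card_eq_fintype_card])
  have hN := orderSystem_pslOrders hq
  have Z := hasColumn_split_nonsplit_unipotent F hq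
  have hcomm := hN.exists_not_commute Z
  obtain ⟨n, hp, hn, hcard⟩ := exists_card_eq_ringChar_pow F
  have hN0 : pslOrders F 0 = (Fintype.card F - 1) / Nat.gcd (Fintype.card F - 1) 2 := rfl
  have hN1 : pslOrders F 1 = (Fintype.card F + 1) / Nat.gcd (Fintype.card F + 1) 2 := rfl
  have hN2 : pslOrders F 2 = ringChar F := rfl
  rcases Nat.lt_or_ge k 4 with hk4 | hk4
  swap
  · exact beauville_of_four_le hcomm hN hk4 hk Z
  by_cases hchar : ringChar F = 2
  · have hF2 : CharP F 2 := hchar ▸ ringChar.charP F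
    rw [hchar] at hcard
    have heven : Even (Fintype.card F) := hcard ▸ Nat.even_pow.2 ⟨even_two, hn.ne'⟩
    have hodd : Odd (Fintype.card F - 1) := Nat.Even.sub_odd (by omega) heven odd_one
    rw [hodd.coprime_two_right.gcd_eq_one, Nat.div_one] at hN0
    rw [heven.add_one.coprime_two_right.gcd_eq_one, Nat.div_one] at hN1
    have hsize : Fintype.card F = 4 ∨ 8 ≤ Fintype.card F := by
      rcases Nat.lt_or_ge n 3 with h | h
      · left
        interval_cases n <;> omega
      · right
        rw [hcard]
        exact Nat.pow_le_pow_right two_pos h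
    have W : HasColumn PSL(2, F) (pslOrders F) ![0, 0, 1] :=
      hsize.elim hasColumn_split_split_nonsplit_of_card_eq_four
        (hasColumn_split_split_nonsplit F)
    obtain rfl | rfl : k = 2 ∨ k = 3 := by omega
    · rcases hsize with h4 | h8
      · exact beauville_two_four hcomm hN hk (by omega) (by omega) Z W
          (hasColumn_nonsplit_nonsplit_unipotent_of_card_eq_four h4)
      · exact beauville_two_even hcomm hN hk (by omega) (by omega) Z W
          (hasColumn_split_split_unipotent F h8) (hasColumn_split_nonsplit_nonsplit F h8)
    · exact beauville_three_even hcomm hN hk (by omega) (by omega) Z W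
  · have hp3 : 3 ≤ ringChar F := by
      have := hp.two_le
      omega
    have P := hasColumn_split_unipotent_unipotent F hq hchar
    obtain rfl | rfl : k = 2 ∨ k = 3 := by omega
    · have hodd := FiniteField.odd_card_of_char_ne_two hchar
      have hgcd : ∀ m, m % 2 = 0 → Nat.gcd m 2 = 2 := fun m hm =>
        Nat.gcd_eq_right (Nat.dvd_of_mod_eq_zero hm)
      rw [hgcd _ (by omega)] at hN0 hN1
      rcases Nat.lt_or_ge (Fintype.card F) 7 with h | h
      · have h5 : Fintype.card F = 5 := by omega
        have hchar5 : ringChar F = 5 :=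
          (Nat.prime_dvd_prime_iff_eq hp (by norm_num)).1
            (h5 ▸ hcard ▸ dvd_pow_self _ hn.ne')
        rw [h5] at hN0 hN1
        rw [hchar5] at hN2
        exact beauville_two_five hcomm hN hk (by omega) (by omega) Z P
          (Z.conj_involution (by omega) (by omega) (by rw [hN2]; decide))
      · exact beauville_two_odd hcomm hN hk (by omega) (by omega) Z P
          (hasColumn_coprime_split_nonsplit F h)
    · exact beauville_three_odd hcomm hN hk (by omega) Z P
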